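/- arXiv:1209.5640 — 6 statements merged into one kernel-verified Lean document; each statement's English description precedes it below -/
import Mathlib

section
/- Let K ≥ 1, and let C₁ and C₂ be two closed subsets of ℝ^n with B_{1/K} ⊂ C₁ ⊂ B_K and B_{1/K} ⊂ C₂ ⊂ B_K. Let f and g be two densities supported respectively in C₁ and C₂, and let u : C₁ → ℝ be a c-convex function such that ∂_c u(C₁) ⊂ B_K and (T_u)_♯ f = g. Let ρ > 0 be such that |C₁| = |ρ C₂| (ρ C₂ being the dilation of C₂ by ρ with respect to the origin), and let v be a convex function on ℝ^n such that ∇v pushes the measure 1_{C₁} dx forward to 1_{ρ C₂} dy and v(0) = u(0). Then there exists an increasing function ω : (0,∞) → (0,∞), depending only on n and K, with ω(δ) ≥ δ and ω(δ) → 0 as δ → 0⁺, such that: if ‖f − 1_{C₁}‖_∞ + ‖g − 1_{C₂}‖_∞ ≤ δ and ‖c(x,y) + x·y‖_{C²(B_K×B_K)} ≤ δ, then ‖u − v‖_{C⁰(B_{1/K})} ≤ ω(δ). -/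
open MeasureTheory Metric Set Filter Asymptotics
open scoped ENNReal NNReal RealInnerProductSpace Pointwise Topology

noncomputable section

/-- Euclidean space `ℝⁿ`. -/
abbrev Euc (n : ℕ) := EuclideanSpace ℝ (Fin n)

/-- `u` is `c`-convex on `X` (with target set `Y`): `u x = sup_{y ∈ Y} (-c x y + lam y)`
for some family of constants `lam y ∈ ℝ ∪ {-∞}`. -/
def CConvexOn {n : ℕ} (X Y : Set (Euc n)) (c : Euc n → Euc n → ℝ) (u : Euc n → ℝ) : Prop :=
  ∃ lam : Euc n → EReal, ∀ x ∈ X,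
    (u x : EReal) = ⨆ y ∈ Y, (((-(c x y) : ℝ) : EReal) + lam y)

/-- The `c`-subdifferential of `u` at `x` (with domain `X` and target `Ybar = closure Y`). -/
def cSubdiff {n : ℕ} (X Ybar : Set (Euc n)) (c : Euc n → Euc n → ℝ) (u : Euc n → ℝ)
    (x : Euc n) : Set (Euc n) :=
  {y | y ∈ Ybar ∧ ∀ z ∈ X, u z ≥ -c z y + c x y + u x}

/-- The Frechet subdifferential of `u` at `x`:
`p` with `u z ≥ u x + ⟪p, z - x⟫ + o (‖z - x‖)` as `z → x`. -/
def frechetSubdiff {n : ℕ} (u : Euc n → ℝ) (x : Euc n) : Set (Euc n) :=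
  {p | ∀ ε > 0, ∀ᶠ z in 𝓝 x, u z ≥ u x + ⟪p, z - x⟫ - ε * ‖z - x‖}

/-- `c` is of class `C²` on `S`, with `‖c (x, y) + x ⬝ y‖_{C²(S)} ≤ δ`. -/
def CostC2CloseOn {n : ℕ} (c : Euc n → Euc n → ℝ) (S : Set (Euc n × Euc n)) (δ : ℝ) : Prop :=
  ∀ p ∈ S,
    ContDiffAt ℝ 2 (fun q : Euc n × Euc n => c q.1 q.2) p ∧
    |c p.1 p.2 + ⟪p.1, p.2⟫| ≤ δ ∧
    ‖fderiv ℝ (fun q : Euc n × Euc n => c q.1 q.2 + ⟪q.1, q.2⟫) p‖ ≤ δ ∧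
    ‖fderiv ℝ (fderiv ℝ (fun q : Euc n × Euc n => c q.1 q.2 + ⟪q.1, q.2⟫)) p‖ ≤ δ

/-- `T` pushes the measure `f(x) dx` forward to `g(y) dy`. -/
def TransportsTo {n : ℕ} (T : Euc n → Euc n) (f g : Euc n → ℝ) : Prop :=
  Measure.map T (volume.withDensity fun x => ENNReal.ofReal (f x)) =
    volume.withDensity fun y => ENNReal.ofReal (g y)

/-- `T = T_u` a.e. on `X`: at a.e. `x ∈ X`, `u` is differentiable and
`T x = c-exp_x (∇u x)`, i.e. `-D_x c (x, T x) = ∇u x`. -/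
def IsTuAE {n : ℕ} (c : Euc n → Euc n → ℝ) (u : Euc n → ℝ) (X : Set (Euc n))
    (T : Euc n → Euc n) : Prop :=
  ∀ᵐ x ∂(volume.restrict X),
    DifferentiableAt ℝ u x ∧ gradient (fun z => c z (T x)) x = -gradient u x

/-- The section `S(x, y, u, h) = {z : u z ≤ u x - c z y + c x y + h}`. -/
def cSection {n : ℕ} (c : Euc n → Euc n → ℝ) (u : Euc n → ℝ) (x y : Euc n) (h : ℝ) :
    Set (Euc n) :=
  {z | u z ≤ u x - c z y + c x y + h}

/-- `f` belongs to the Hölder space `C^{k,α}(s)`. -/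
def HolderSp {E F : Type*} [NormedAddCommGroup E] [NormedSpace ℝ E]
    [NormedAddCommGroup F] [NormedSpace ℝ F] (k : ℕ) (α : ℝ) (f : E → F) (s : Set E) : Prop :=
  ContDiffOn ℝ k f s ∧
    ∃ C : ℝ≥0, HolderOnWith C α.toNNReal (iteratedFDerivWithin ℝ k f s) s

theorem exists_modulus (P : ℝ → ℝ → Prop)
    (hb : ∀ δ > 0, ∃ M, ∀ δ' t, 0 < δ' → δ' ≤ δ → P δ' t → t ≤ M)
    (h0 : ∀ ε > 0, ∃ δ > 0, ∀ δ' t, 0 < δ' → δ' ≤ δ → P δ' t → t ≤ ε) :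
    ∃ ω : ℝ → ℝ, (∀ s t : ℝ, 0 < s → s ≤ t → ω s ≤ ω t) ∧ (∀ δ > (0 : ℝ), δ ≤ ω δ) ∧
      Tendsto ω (𝓝[>] 0) (𝓝 0) ∧ ∀ δ t, 0 < δ → P δ t → t ≤ ω δ := by
  let A : ℝ → Set ℝ := fun δ => insert 0 {t | ∃ δ', 0 < δ' ∧ δ' ≤ δ ∧ P δ' t}
  have hA : ∀ δ > 0, BddAbove (A δ) := by
    intro δ hδ
    obtain ⟨M, hM⟩ := hb δ hδ
    refine BddAbove.insert 0 ⟨M, ?_⟩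
    rintro t ⟨δ', h1, h2, h3⟩
    exact hM δ' t h1 h2 h3
  have hA0 : ∀ δ > 0, 0 ≤ sSup (A δ) := fun δ hδ => le_csSup (hA δ hδ) (mem_insert _ _)
  refine ⟨fun δ => δ + sSup (A δ), ?_, ?_, ?_, ?_⟩
  · intro s t hs hst
    refine add_le_add hst (csSup_le_csSup (hA t (hs.trans_le hst)) ⟨0, mem_insert _ _⟩ ?_)
    refine insert_subset_insert ?_
    rintro r ⟨δ', h1, h2, h3⟩
    exact ⟨δ', h1, h2.trans hst, h3⟩
  · intro δ hδ
    linarith [hA0 δ hδ]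
  · rw [Metric.tendsto_nhdsWithin_nhds]
    intro ε hε
    obtain ⟨δ, hδ, h⟩ := h0 (ε / 2) (by positivity)
    refine ⟨min δ (ε / 2), by positivity, fun x hx hxd => ?_⟩
    have hx0 : (0 : ℝ) < x := hx
    rw [Real.dist_eq, sub_zero, abs_of_pos hx0] at hxd
    have h1 : sSup (A x) ≤ ε / 2 := by
      refine csSup_le ⟨0, mem_insert _ _⟩ ?_
      rintro t (rfl | ⟨δ', h1, h2, h3⟩)
      · positivity
      · exact h δ' t h1 (h2.trans (hxd.le.trans (min_le_left _ _))) h3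
    have h2 := hA0 x hx0
    rw [Real.dist_eq, sub_zero, abs_of_nonneg (by positivity)]
    linarith [hxd.trans_le (min_le_right δ (ε / 2))]
  · intro δ t hδ ht
    have : t ≤ sSup (A δ) := le_csSup (hA δ hδ) (mem_insert_of_mem _ ⟨δ, hδ, le_rfl, ht⟩)
    linarith

section Directions

variable {E : Type*} [NormedAddCommGroup E] [InnerProductSpace ℝ E]

/-- Every direction is asymptotically realised by points of `s` close to `x`. -/
def FullTangent (s : Set E) (x : E) : Prop :=
  ∀ e : E, ∀ ε > 0, ∀ ρ > 0, ∃ r : ℝ, 0 < r ∧ ∃ a : E, ‖a - e‖ ≤ ε ∧ x + r • a ∈ s ∧ ‖r • a‖ < ρ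

theorem ae_fullTangent [FiniteDimensional ℝ E] [MeasurableSpace E] [BorelSpace E]
    {s : Set E} (hs : MeasurableSet s) (μ : Measure E) [μ.IsAddHaarMeasure] :
    ∀ᵐ x ∂μ.restrict s, FullTangent s x := by
  filter_upwards [Besicovitch.ae_tendsto_measure_inter_div μ s, ae_restrict_mem hs]
  intro x hx xs e ε hε ρ hρ
  have B₁ : ∀ᶠ r in 𝓝[>] (0 : ℝ), (s ∩ ({x} + r • closedBall e ε)).Nonempty :=
    Measure.eventually_nonempty_inter_smul_of_density_one μ s x hx _ measurableSet_closedBall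
      (measure_closedBall_pos μ e hε).ne'
  have B₂ : ∀ᶠ r in 𝓝[>] (0 : ℝ), {x} + r • closedBall e ε ⊆ ball x ρ :=
    nhdsWithin_le_nhds (eventually_singleton_add_smul_subset isBounded_closedBall
      (ball_mem_nhds x hρ))
  obtain ⟨r, ⟨y, ys, hy⟩, hr, rpos⟩ := (B₁.and (B₂.and self_mem_nhdsWithin)).exists
  have hyb := hr hy
  rw [singleton_add, mem_image] at hy
  obtain ⟨w, hw, rfl⟩ := hy
  obtain ⟨a, ha, rfl⟩ := hw
  refine ⟨r, rpos, a, by simpa [dist_eq_norm] using ha, ys, ?_⟩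
  simpa [dist_eq_norm] using hyb

theorem norm_sub_gradient_le [CompleteSpace E] {s : Set E} {x q : E} {u : E → ℝ} {δ : ℝ}
    (hx : FullTangent s x) (hu : DifferentiableAt ℝ u x)
    (h : ∀ z ∈ s, u x + ⟪z - x, q⟫ - δ * ‖z - x‖ ≤ u z) (hδ : 0 ≤ δ) :
    ‖q - gradient u x‖ ≤ δ := by
  set p := gradient u x with hp
  set e := q - p with he
  have key : ∀ ε > 0, ‖e‖ * ‖e‖ - ε * ‖e‖ ≤ (δ + ε) * (‖e‖ + ε) := by
    intro ε hε
    have h1 := (hasGradientAt_iff_isLittleO.1 hu.hasGradientAt).def hε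
    rw [Metric.eventually_nhds_iff] at h1
    obtain ⟨ρ, hρ, h1⟩ := h1
    obtain ⟨r, hr, a, ha, has, har⟩ := hx e ε hε ρ hρ
    have h2 := h1 (y := x + r • a) (by simpa [dist_eq_norm] using har)
    have h3 := h _ has
    simp only [add_sub_cancel_left] at h2 h3
    rw [← hp, inner_smul_right, norm_smul, Real.norm_of_nonneg hr.le, Real.norm_eq_abs] at h2
    rw [inner_smul_left, norm_smul, Real.norm_of_nonneg hr.le] at h3
    simp only [conj_trivial] at h3
    have h4 := (abs_le.1 h2).2
    have h5 : r * ⟪a, e⟫ ≤ r * ((δ + ε) * ‖a‖) := by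
      rw [he, inner_sub_right, real_inner_comm a p] at *
      nlinarith
    have h6 : ⟪a, e⟫ ≤ (δ + ε) * ‖a‖ := le_of_mul_le_mul_left h5 hr
    have h7 : ‖e‖ * ‖e‖ - ε * ‖e‖ ≤ ⟪a, e⟫ := by
      have : ⟪a, e⟫ = ⟪a - e, e⟫ + ‖e‖ * ‖e‖ := by
        rw [inner_sub_left, real_inner_self_eq_norm_mul_norm]; ring
      rw [this]
      have h8 := abs_real_inner_le_norm (a - e) e
      have h9 := mul_le_mul_of_nonneg_right ha (norm_nonneg e)
      linarith [(abs_le.1 h8).1]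
    have h8 : ‖a‖ ≤ ‖e‖ + ε := by
      have := norm_add_le (a - e) e
      rw [sub_add_cancel] at this
      linarith
    have := mul_le_mul_of_nonneg_left h8 (show 0 ≤ δ + ε by positivity)
    linarith
  have lim : ‖e‖ * ‖e‖ ≤ δ * ‖e‖ := by
    have t1 : Tendsto (fun ε : ℝ => ‖e‖ * ‖e‖ - ε * ‖e‖) (𝓝[>] 0) (𝓝 (‖e‖ * ‖e‖ - 0 * ‖e‖)) :=
      Tendsto.mono_left (Continuous.tendsto (by fun_prop) 0) nhdsWithin_le_nhds
    have t2 : Tendsto (fun ε : ℝ => (δ + ε) * (‖e‖ + ε)) (𝓝[>] 0) (𝓝 ((δ + 0) * (‖e‖ + 0))) :=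
      Tendsto.mono_left (Continuous.tendsto (by fun_prop) 0) nhdsWithin_le_nhds
    simp only [zero_mul, sub_zero, add_zero] at t1 t2
    refine le_of_tendsto_of_tendsto t1 t2 ?_
    filter_upwards [self_mem_nhdsWithin] with ε hε using key ε hε
  rcases (norm_nonneg e).eq_or_lt with h0 | h0
  · rw [← h0]; exact hδ
  · exact le_of_mul_le_mul_right lim h0

end Directions

/-- `q` is a subgradient of `w` at `x` relative to `A`, up to the error `η`. -/
def ApproxSubgrad {E : Type*} [NormedAddCommGroup E] [InnerProductSpace ℝ E]
    (w : E → ℝ) (A : Set E) (x q : E) (η : ℝ) : Prop :=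
  ∀ z ∈ A, w x + ⟪z - x, q⟫ - η ≤ w z

section Cost

variable {n : ℕ} {K δ : ℝ} {c : Euc n → Euc n → ℝ}

theorem CostC2CloseOn.abs_sub_le
    (hc : CostC2CloseOn c (ball (0 : Euc n) K ×ˢ ball (0 : Euc n) K) δ)
    {x z y : Euc n} (hx : x ∈ ball (0 : Euc n) K) (hz : z ∈ ball (0 : Euc n) K)
    (hy : y ∈ ball (0 : Euc n) K) :
    |(c z y + ⟪z, y⟫) - (c x y + ⟪x, y⟫)| ≤ δ * ‖z - x‖ := by
  have hd : ∀ w ∈ ball (0 : Euc n) K ×ˢ ball (0 : Euc n) K, DifferentiableAt ℝ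
      (fun q : Euc n × Euc n => c q.1 q.2 + ⟪q.1, q.2⟫) w := by
    intro w hw
    refine ((hc w hw).1.differentiableAt (by norm_num)).add ?_
    exact DifferentiableAt.inner ℝ differentiableAt_fst differentiableAt_snd
  have := Convex.norm_image_sub_le_of_norm_fderiv_le (𝕜 := ℝ) hd (fun w hw => (hc w hw).2.2.1)
    ((convex_ball (0 : Euc n) K).prod (convex_ball (0 : Euc n) K))
    (mk_mem_prod hx hy) (mk_mem_prod hz hy)
  simpa [Prod.norm_def] using this

/-- At a point where `u` is differentiable, `c`-exp moves the gradient by at most `δ`. -/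
theorem CostC2CloseOn.norm_sub_gradient_le
    (hc : CostC2CloseOn c (ball (0 : Euc n) K ×ˢ ball (0 : Euc n) K) δ)
    {x y p : Euc n} (hx : x ∈ ball (0 : Euc n) K) (hy : y ∈ ball (0 : Euc n) K)
    (hp : gradient (fun z => c z y) x = -p) : ‖y - p‖ ≤ δ := by
  have hw := hc (x, y) (mk_mem_prod hx hy)
  have hd : DifferentiableAt ℝ (fun q : Euc n × Euc n => c q.1 q.2) (x, y) :=
    hw.1.differentiableAt (by norm_num)
  have h2 : DifferentiableAt ℝ (fun q : Euc n × Euc n => c q.1 q.2 + ⟪q.1, q.2⟫) (x, y) :=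
    hd.add (DifferentiableAt.inner ℝ differentiableAt_fst differentiableAt_snd)
  have hinl : HasFDerivAt (fun z : Euc n => (z, y)) (ContinuousLinearMap.inl ℝ (Euc n) (Euc n)) x :=
    hasFDerivAt_prodMk_left x y
  have h3 := h2.hasFDerivAt.comp x hinl
  have hcy := hd.hasFDerivAt.comp x hinl
  have h4 : HasFDerivAt (fun z : Euc n => c z y) (fderiv ℝ (fun z => c z y) x) x :=
    hcy.differentiableAt.hasFDerivAt
  have h5 : HasFDerivAt (fun z : Euc n => ⟪z, y⟫) (innerSL ℝ y) x := by
    have : (fun z : Euc n => ⟪z, y⟫) = fun z => innerSL ℝ y z := by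
      ext z; simp [real_inner_comm]
    rw [this]
    exact (innerSL ℝ y).hasFDerivAt
  have h6 := h3.unique (h4.add h5)
  have h7 : (InnerProductSpace.toDual ℝ (Euc n)) (y - p) =
      fderiv ℝ (fun z => c z y) x + innerSL ℝ y := by
    have h8 : fderiv ℝ (fun z => c z y) x = InnerProductSpace.toDual ℝ (Euc n) (-p) := by
      rw [← hp, gradient, LinearIsometryEquiv.apply_symm_apply]
    rw [h8]
    ext z
    simp
    ring
  rw [← (InnerProductSpace.toDual ℝ (Euc n)).norm_map, h7, ← h6]
  refine (ContinuousLinearMap.opNorm_comp_le _ _).trans ?_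
  have := ContinuousLinearMap.norm_inl_le_one ℝ (Euc n) (Euc n)
  calc _ ≤ δ * 1 := mul_le_mul hw.2.2.1 this (norm_nonneg _) ((norm_nonneg _).trans hw.2.2.1)
    _ = δ := mul_one _

theorem CConvexOn.exists_approxSubgrad {C : Set (Euc n)} {u : Euc n → ℝ}
    (hu : CConvexOn C (ball (0 : Euc n) K) c u) (hC : C ⊆ ball (0 : Euc n) K)
    (hc : CostC2CloseOn c (ball (0 : Euc n) K ×ˢ ball (0 : Euc n) K) δ)
    {x : Euc n} (hx : x ∈ C) :
    ∃ q : Euc n, ‖q‖ ≤ K ∧ (∀ z ∈ C, u x + ⟪z - x, q⟫ - δ * ‖z - x‖ ≤ u z) ∧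
      ApproxSubgrad u C x q (2 * δ) := by
  obtain ⟨lam, hlam⟩ := hu
  have step : ∀ k : ℕ, ∃ y ∈ ball (0 : Euc n) K, ∀ z ∈ C,
      u x - c z y + c x y - 1 / ((k : ℝ) + 1) ≤ u z := by
    intro k
    have hk : (0 : ℝ) < 1 / ((k : ℝ) + 1) := by positivity
    have h1 : ((u x - 1 / ((k : ℝ) + 1) : ℝ) : EReal) <
        ⨆ y ∈ ball (0 : Euc n) K, (((-(c x y) : ℝ) : EReal) + lam y) := by
      rw [← hlam x hx]
      exact_mod_cast sub_lt_self _ hk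
    rw [lt_iSup_iff] at h1
    obtain ⟨y, h1⟩ := h1
    rw [lt_iSup_iff] at h1
    obtain ⟨hy, h1⟩ := h1
    refine ⟨y, hy, fun z hz => ?_⟩
    have h2 : ∀ w ∈ C, ((-(c w y) : ℝ) : EReal) + lam y ≤ (u w : EReal) := by
      intro w hw
      rw [hlam w hw]
      exact le_iSup₂ (f := fun y (_ : y ∈ ball (0 : Euc n) K) =>
        (((-(c w y) : ℝ) : EReal) + lam y)) y hy
    have h3 := h2 x hx
    have h4 := h2 z hz
    generalize lam y = l at *
    induction l with
    | bot => simp at h1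
    | top => simp at h3
    | coe l =>
      norm_cast at h1 h4
      push_cast at h1
      linarith
  choose y hy hyu using step
  obtain ⟨q, hq, φ, hφ, hlim⟩ := (isCompact_closedBall (0 : Euc n) K).tendsto_subseq
    (fun k => ball_subset_closedBall (hy k))
  have hε : Tendsto (fun k => 1 / (((φ k : ℕ) : ℝ) + 1)) atTop (𝓝 0) :=
    tendsto_one_div_add_atTop_nhds_zero_nat.comp hφ.tendsto_atTop
  have hbound : ∀ z ∈ C, ∀ b : ℝ, (∀ k, c z (y k) + ⟪z, y k⟫ - (c x (y k) + ⟪x, y k⟫) ≤ b) →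
      u x + ⟪z - x, q⟫ - b ≤ u z := by
    intro z hz b hb
    have t1 : Tendsto (fun k => u x + ⟪z - x, y (φ k)⟫ - b - 1 / (((φ k : ℕ) : ℝ) + 1)) atTop
        (𝓝 (u x + ⟪z - x, q⟫ - b - 0)) :=
      (((tendsto_const_nhds.inner hlim).const_add _).sub_const _).sub hε
    rw [sub_zero] at t1
    refine le_of_tendsto t1 (Eventually.of_forall fun k => ?_)
    have h1 := hyu (φ k) z hz
    have h2 := hb (φ k)
    rw [inner_sub_left]
    linarith
  refine ⟨q, by simpa using hq, fun z hz => hbound z hz _ fun k => ?_,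
    fun z hz => hbound z hz _ fun k => ?_⟩
  · exact (abs_le.1 (hc.abs_sub_le (hC hx) (hC hz) (hy k))).2
  · have h1 := (abs_le.1 (hc (z, y k) (mk_mem_prod (hC hz) (hy k))).2.1).2
    have h2 := (abs_le.1 (hc (x, y k) (mk_mem_prod (hC hx) (hy k))).2.1).1
    linarith

/-- A `c`-convex function is Lipschitz. -/
theorem CConvexOn.abs_sub_le {C : Set (Euc n)} {u : Euc n → ℝ}
    (hu : CConvexOn C (ball (0 : Euc n) K) c u) (hC : C ⊆ ball (0 : Euc n) K)
    (hc : CostC2CloseOn c (ball (0 : Euc n) K ×ˢ ball (0 : Euc n) K) δ)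
    {x z : Euc n} (hx : x ∈ C) (hz : z ∈ C) : |u x - u z| ≤ (K + δ) * ‖x - z‖ := by
  have key : ∀ x ∈ C, ∀ z ∈ C, u x - u z ≤ (K + δ) * ‖x - z‖ := by
    intro x hx z hz
    obtain ⟨q, hq, h, -⟩ := hu.exists_approxSubgrad hC hc hx
    have h1 := h z hz
    have h2 := (abs_le.1 (abs_real_inner_le_norm (z - x) q)).1
    have h3 := mul_le_mul_of_nonneg_left hq (norm_nonneg (z - x))
    rw [norm_sub_rev x z]
    linarith
  rw [abs_le]
  have := key z hz x hx
  rw [norm_sub_rev] at this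
  exact ⟨by linarith, key x hx z hz⟩

/-- The `c`-exponential of the gradient of a `c`-convex function is an approximate subgradient. -/
theorem CConvexOn.approxSubgrad_of_gradient {C : Set (Euc n)} {u : Euc n → ℝ}
    (hu : CConvexOn C (ball (0 : Euc n) K) c u) (hC : C ⊆ ball (0 : Euc n) K)
    (hc : CostC2CloseOn c (ball (0 : Euc n) K ×ˢ ball (0 : Euc n) K) δ) (hδ : 0 ≤ δ)
    {x y : Euc n} (hx : x ∈ C) (hxt : FullTangent C x) (hy : y ∈ ball (0 : Euc n) K)
    (hd : DifferentiableAt ℝ u x) (hg : gradient (fun z => c z y) x = -gradient u x) :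
    ApproxSubgrad u C x y (4 * K * δ + 2 * δ) := by
  obtain ⟨q, hq, h1, h2⟩ := hu.exists_approxSubgrad hC hc hx
  have h3 := _root_.norm_sub_gradient_le hxt hd h1 hδ
  have h4 := hc.norm_sub_gradient_le (hC hx) hy hg
  have h5 : ‖y - q‖ ≤ 2 * δ := by
    have := norm_sub_le (y - gradient u x) (q - gradient u x)
    rw [sub_sub_sub_cancel_right] at this
    linarith
  intro z hz
  have h6 := h2 z hz
  have h7 : ⟪z - x, y⟫ = ⟪z - x, q⟫ + ⟪z - x, y - q⟫ := by rw [inner_sub_right]; ring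
  have h8 := (abs_le.1 (abs_real_inner_le_norm (z - x) (y - q))).2
  have h9 : ‖z - x‖ ≤ 2 * K := by
    have := norm_sub_le z x
    have a := hC hx
    have b := hC hz
    rw [mem_ball_zero_iff] at a b
    linarith
  have h10 : ‖z - x‖ * ‖y - q‖ ≤ 2 * K * (2 * δ) :=
    mul_le_mul h9 h5 (norm_nonneg _) ((norm_nonneg _).trans h9)
  linarith

end Cost
section Convex

variable {n : ℕ} {v : Euc n → ℝ}

theorem ConvexOn.add_inner_gradient_le (hv : ConvexOn ℝ univ v) {x : Euc n}
    (hx : DifferentiableAt ℝ v x) (z : Euc n) : v x + ⟪z - x, gradient v x⟫ ≤ v z := by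
  have hg : ConvexOn ℝ univ (fun t : ℝ => v (AffineMap.lineMap x z t)) := by
    simpa [Function.comp_def] using
      hv.comp_affineMap (AffineMap.lineMap x z : ℝ →ᵃ[ℝ] Euc n)
  have hd : HasDerivAt (fun t : ℝ => v (AffineMap.lineMap x z t)) (fderiv ℝ v x (z - x)) 0 := by
    have h1 : HasDerivAt (fun t : ℝ => (AffineMap.lineMap x z t : Euc n)) (z - x) 0 :=
      AffineMap.hasDerivAt_lineMap
    have h2 : HasFDerivAt v (fderiv ℝ v x) (AffineMap.lineMap x z (0 : ℝ)) := by
      simpa using hx.hasFDerivAt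
    exact h2.comp_hasDerivAt (0 : ℝ) h1
  have h := hg.le_slope_of_hasDerivAt (mem_univ 0) (mem_univ 1) zero_lt_one hd
  have h2 : ⟪z - x, gradient v x⟫ = fderiv ℝ v x (z - x) := by
    rw [real_inner_comm]
    exact InnerProductSpace.toDual_symm_apply
  rw [h2]
  rw [slope_def_field] at h
  simp only [AffineMap.lineMap_apply_one, AffineMap.lineMap_apply_zero, sub_zero, div_one] at h
  linarith

theorem ConvexOn.ae_differentiableAt (hv : ConvexOn ℝ univ v) :
    ∀ᵐ x, DifferentiableAt ℝ v x := by
  have hl := hv.locallyLipschitz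
  choose L t ht hL using hl
  obtain ⟨s, hs, hcov⟩ := TopologicalSpace.countable_cover_nhds
    fun x => interior_mem_nhds.2 (ht x)
  have h : ∀ᵐ x, ∀ i ∈ s, x ∈ interior (t i) → DifferentiableAt ℝ v x := by
    rw [ae_ball_iff hs]
    intro i hi
    filter_upwards [((hL i).mono interior_subset).ae_differentiableWithinAt_of_mem] with x hx hxi
    exact (hx hxi).differentiableAt (isOpen_interior.mem_nhds hxi)
  filter_upwards [h] with x hx
  obtain ⟨i, hi, hxi⟩ := mem_iUnion₂.1 (hcov.symm ▸ mem_univ x)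
  exact hx i hi hxi

theorem measurable_gradient (w : Euc n → ℝ) : Measurable (fun x => gradient w x) := by
  exact (InnerProductSpace.toDual ℝ (Euc n)).symm.continuous.measurable.comp (measurable_fderiv ℝ w)

end Convex
section Chain

variable {n : ℕ}

theorem exists_common_translate {N : ℕ} {U A : Set (Euc n)} {p : ℕ → Euc n} {r : ℝ}
    (hU : ∀ i ≤ N, ∀ a ∈ ball (0 : Euc n) r, p i + a ∈ U)
    (hA : ((N + 1 : ℕ) : ℝ≥0∞) * volume (U \ A) < volume (ball (0 : Euc n) r)) :
    ∃ a ∈ ball (0 : Euc n) r, ∀ i ≤ N, p i + a ∈ A := by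
  by_contra! h
  have hsub : ball (0 : Euc n) r ⊆
      ⋃ i ∈ Finset.range (N + 1), (fun a => p i + a) ⁻¹' (U \ A) := by
    intro a ha
    obtain ⟨i, hi, hia⟩ := h a ha
    exact mem_iUnion₂.2 ⟨i, Finset.mem_range.2 (Nat.lt_succ_of_le hi), hU i hi a ha, hia⟩
  refine absurd hA (not_lt.2 ?_)
  calc volume (ball (0 : Euc n) r) ≤ _ := measure_mono hsub
    _ ≤ ∑ i ∈ Finset.range (N + 1), volume ((fun a => p i + a) ⁻¹' (U \ A)) :=
      measure_biUnion_finset_le _ _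
    _ = ((N + 1 : ℕ) : ℝ≥0∞) * volume (U \ A) := by
      simp only [measure_preimage_add, Finset.sum_const, Finset.card_range, nsmul_eq_mul]

theorem abs_sub_le_of_chain {u v : Euc n → ℝ} {S : Euc n → Euc n} {A : Set (Euc n)} {s R : ℝ}
    (hu : ∀ x ∈ A, ApproxSubgrad u A x (S x) s) (hv : ∀ x ∈ A, ApproxSubgrad v A x (S x) 0)
    (hS : ∀ x ∈ A, ‖S x‖ ≤ R) {N : ℕ} {p : ℕ → Euc n} {h : Euc n}
    (hp : ∀ i, p (i + 1) = p i + h) (hpA : ∀ i ≤ N, p i ∈ A) :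
    |(u (p N) - v (p N)) - (u (p 0) - v (p 0))| ≤ 2 * R * ‖h‖ + N * s := by
  have key : ∀ k ≤ N, |(u (p k) - v (p k)) - (u (p 0) - v (p 0))| ≤
      ⟪S (p k) - S (p 0), h⟫ + k * s := by
    intro k
    induction k with
    | zero => simp
    | succ k ih =>
      intro hk
      have h0 := abs_le.1 (ih (by omega))
      have m1 := hpA k (by omega)
      have m2 := hpA (k + 1) hk
      have a1 := hu _ m1 _ m2
      have a2 := hu _ m2 _ m1
      have a3 := hv _ m1 _ m2
      have a4 := hv _ m2 _ m1
      have e1 : p (k + 1) - p k = h := by rw [hp]; abel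
      have e2 : p k - p (k + 1) = -h := by rw [hp]; abel
      rw [e1, real_inner_comm] at a1 a3
      rw [e2, inner_neg_left, real_inner_comm] at a2 a4
      rw [inner_sub_left] at h0 ⊢
      push_cast
      rw [abs_le]
      constructor <;> linarith
  refine (key N le_rfl).trans ?_
  have h1 := real_inner_le_norm (S (p N) - S (p 0)) h
  have h2 : ‖S (p N) - S (p 0)‖ ≤ 2 * R := by
    linarith [norm_sub_le (S (p N)) (S (p 0)), hS _ (hpA N le_rfl), hS _ (hpA 0 (Nat.zero_le _))]
  have h3 := mul_le_mul_of_nonneg_right h2 (norm_nonneg h)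
  linarith

/-- Two Lipschitz functions that share approximate subgradients on most of a ball nearly differ
by a constant. -/
theorem abs_sub_le_of_common_subgrad {u v : Euc n → ℝ} {S : Euc n → Euc n} {A : Set (Euc n)}
    {K r s R L : ℝ} {N : ℕ} (hK : 1 ≤ K) (hN : 0 < N) (hr : 0 < r) (hrK : r * K < 1)
    (hu : ∀ x ∈ A, ApproxSubgrad u A x (S x) s) (hv : ∀ x ∈ A, ApproxSubgrad v A x (S x) 0)
    (hS : ∀ x ∈ A, ‖S x‖ ≤ R)
    (hL : ∀ x ∈ ball (0 : Euc n) (1 / K), ∀ z ∈ ball (0 : Euc n) (1 / K),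
      |(u x - v x) - (u z - v z)| ≤ L * ‖x - z‖) (hL0 : 0 ≤ L) (hR0 : 0 ≤ R)
    (hA : ((N + 1 : ℕ) : ℝ≥0∞) * volume (ball (0 : Euc n) (1 / K) \ A) <
      volume (ball (0 : Euc n) r)) {x : Euc n} (hx : x ∈ ball (0 : Euc n) (1 / K)) :
    |(u x - v x) - (u 0 - v 0)| ≤ 3 * L * r + 2 * R / N + N * s := by
  have hK0 : 0 < K := by linarith
  have hN0 : (0 : ℝ) < N := by exact_mod_cast hN
  rw [mem_ball_zero_iff] at hx
  have hxK : K * ‖x‖ ≤ 1 := by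
    rw [lt_div_iff₀ hK0] at hx
    linarith
  set p : ℕ → Euc n := fun i => ((i : ℝ) / N * (1 - r * K)) • x with hp
  have hball : ∀ i ≤ N, ∀ a ∈ ball (0 : Euc n) r, p i + a ∈ ball (0 : Euc n) (1 / K) := by
    intro i hi a ha
    rw [mem_ball_zero_iff] at ha ⊢
    have hi' : (i : ℝ) / N ≤ 1 := by
      rw [div_le_one hN0]
      exact_mod_cast hi
    have h1 : ‖p i‖ ≤ (1 - r * K) * (1 / K) := by
      rw [hp]
      simp only [norm_smul, norm_mul, Real.norm_eq_abs]
      rw [abs_of_nonneg (by positivity), abs_of_pos (by linarith)]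
      refine mul_le_mul ?_ hx.le (norm_nonneg _) (by linarith)
      have := mul_le_mul_of_nonneg_right hi' (show 0 ≤ 1 - r * K by linarith)
      linarith
    have h2 : (1 - r * K) * (1 / K) = 1 / K - r := by field_simp
    linarith [norm_add_le (p i) a]
  obtain ⟨a, ha, haA⟩ := exists_common_translate hball hA
  have hchain := abs_sub_le_of_chain hu hv hS (p := fun i => p i + a) (N := N)
    (h := (1 / (N : ℝ) * (1 - r * K)) • x)
    (fun i => by
      simp only [hp]
      push_cast
      rw [add_right_comm, ← add_smul]
      congr 2
      ring) haA
  have har := mem_ball_zero_iff.1 ha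
  have e1 := hball N le_rfl a ha
  have e0 := hball 0 (Nat.zero_le _) a ha
  have hzero : (0 : Euc n) ∈ ball (0 : Euc n) (1 / K) := mem_ball_self (by positivity)
  have b1 := hL x (mem_ball_zero_iff.2 hx) _ e1
  have b0 := hL _ e0 _ hzero
  have n1 : ‖x - (p N + a)‖ ≤ 2 * r := by
    have : x - (p N + a) = (r * K) • x - a := by
      simp only [hp]
      rw [div_self hN0.ne', one_mul, sub_smul, one_smul]
      abel
    rw [this]
    refine (norm_sub_le _ _).trans ?_
    rw [norm_smul, Real.norm_of_nonneg (by positivity)]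
    have := mul_le_mul_of_nonneg_left hxK hr.le
    linarith
  have n0 : ‖p 0 + a - 0‖ ≤ r := by
    simp only [hp]
    simpa using har.le
  have nh : ‖(1 / (N : ℝ) * (1 - r * K)) • x‖ ≤ 1 / N := by
    rw [norm_smul, norm_mul, Real.norm_of_nonneg (by positivity),
      Real.norm_of_nonneg (by linarith), mul_assoc]
    refine mul_le_of_le_one_right (by positivity) ?_
    have h1 : ‖x‖ ≤ 1 := by nlinarith [norm_nonneg x]
    have h2 : 1 - r * K ≤ 1 := by nlinarith
    exact mul_le_one₀ h2 (norm_nonneg _) h1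
  have b1' := abs_le.1 (b1.trans (mul_le_mul_of_nonneg_left n1 hL0))
  have b0' := abs_le.1 (b0.trans (mul_le_mul_of_nonneg_left n0 hL0))
  have bh := mul_le_mul_of_nonneg_left nh (show 0 ≤ 2 * R by positivity)
  have bc := abs_le.1 hchain
  have : 2 * R * (1 / N) = 2 * R / N := by ring
  rw [abs_le]
  constructor <;> linarith

end Chain

section RelConj

variable {n : ℕ} {A : Set (Euc n)} {w : Euc n → ℝ} {K W : ℝ}

/-- The Legendre transform of `w` relative to the set `A`. -/
def relConj (A : Set (Euc n)) (w : Euc n → ℝ) (y : Euc n) : ℝ :=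
  sSup ((fun z => ⟪z, y⟫ - w z) '' A)

theorem relConj_le (hA : A.Nonempty) {y : Euc n} {b : ℝ} (h : ∀ z ∈ A, ⟪z, y⟫ - w z ≤ b) :
    relConj A w y ≤ b :=
  csSup_le (hA.image _) (by rintro _ ⟨z, hz, rfl⟩; exact h z hz)

theorem inner_sub_le_of_bound (hK : ∀ z ∈ A, ‖z‖ ≤ K) (hW : ∀ z ∈ A, |w z| ≤ W) (y : Euc n)
    {z : Euc n} (hz : z ∈ A) : |⟪z, y⟫ - w z| ≤ K * ‖y‖ + W := by
  have h1 := abs_real_inner_le_norm z y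
  have h2 := mul_le_mul_of_nonneg_right (hK z hz) (norm_nonneg y)
  linarith [abs_sub ⟪z, y⟫ (w z), hW z hz]

theorem le_relConj (hK : ∀ z ∈ A, ‖z‖ ≤ K) (hW : ∀ z ∈ A, |w z| ≤ W) (y : Euc n)
    {z : Euc n} (hz : z ∈ A) : ⟪z, y⟫ - w z ≤ relConj A w y := by
  refine le_csSup ⟨K * ‖y‖ + W, ?_⟩ ⟨z, hz, rfl⟩
  rintro _ ⟨x, hx, rfl⟩
  exact (abs_le.1 (inner_sub_le_of_bound hK hW y hx)).2

theorem abs_relConj_le (hA : A.Nonempty) (hK : ∀ z ∈ A, ‖z‖ ≤ K) (hW : ∀ z ∈ A, |w z| ≤ W)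
    (y : Euc n) : |relConj A w y| ≤ K * ‖y‖ + W := by
  obtain ⟨z, hz⟩ := hA
  rw [abs_le]
  constructor
  · exact (abs_le.1 (inner_sub_le_of_bound hK hW y hz)).1.trans (le_relConj hK hW y hz)
  · exact relConj_le ⟨z, hz⟩ fun x hx => (abs_le.1 (inner_sub_le_of_bound hK hW y hx)).2

theorem abs_relConj_sub_le (hA : A.Nonempty) (hK : ∀ z ∈ A, ‖z‖ ≤ K) (hW : ∀ z ∈ A, |w z| ≤ W)
    (y y' : Euc n) : |relConj A w y - relConj A w y'| ≤ K * ‖y - y'‖ := by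
  have key : ∀ y y' : Euc n, relConj A w y ≤ relConj A w y' + K * ‖y - y'‖ := by
    intro y y'
    refine relConj_le hA fun z hz => ?_
    have h1 := le_relConj hK hW y' hz
    have h2 := real_inner_le_norm z (y - y')
    have h3 := mul_le_mul_of_nonneg_right (hK z hz) (norm_nonneg (y - y'))
    rw [inner_sub_right] at h2
    linarith
  have h1 := key y y'
  have h2 := key y' y
  rw [norm_sub_rev] at h2
  rw [abs_le]
  constructor <;> linarith

end RelConj
section Integrals

variable {α : Type*} [MeasurableSpace α]

theorem measureReal_univ_le {μ F : Measure α} [IsFiniteMeasure μ] {δ : ℝ} (hδ : 0 ≤ 1 + δ)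
    (hup : F ≤ ENNReal.ofReal (1 + δ) • μ) : F.real univ ≤ (1 + δ) * μ.real univ := by
  have h := ENNReal.toReal_mono (by rw [Measure.smul_apply, smul_eq_mul]; finiteness) (hup univ)
  rwa [Measure.smul_apply, smul_eq_mul, ENNReal.toReal_mul, ENNReal.toReal_ofReal hδ] at h

theorem integral_le_integral_add_of_smul_le {μ F : Measure α} [IsFiniteMeasure μ] {δ M : ℝ}
    (hδ : 0 ≤ δ) (hδ1 : δ ≤ 1)
    (hlow : ENNReal.ofReal (1 - δ) • μ ≤ F) (hup : F ≤ ENNReal.ofReal (1 + δ) • μ)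
    {φ : α → ℝ} (hφ : AEStronglyMeasurable φ μ) (hM : ∀ᵐ x ∂μ, |φ x| ≤ M) (hM0 : 0 ≤ M) :
    ∫ x, φ x ∂μ ≤ ∫ x, φ x ∂F + 3 * δ * M * μ.real univ := by
  have hac : F ≪ μ := Measure.absolutelyContinuous_of_le_smul hup
  have : IsFiniteMeasure F := by
    refine ⟨(hup univ).trans_lt ?_⟩
    rw [Measure.smul_apply, smul_eq_mul]
    exact ENNReal.mul_lt_top ENNReal.ofReal_lt_top (measure_lt_top _ _)
  have iμ : Integrable φ μ := Integrable.of_bound hφ M hM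
  have iF : Integrable φ F := Integrable.of_bound (hφ.mono_ac hac) M (hac.ae_le hM)
  have h1 : ∫ x, (φ x + M) ∂(ENNReal.ofReal (1 - δ) • μ) ≤ ∫ x, (φ x + M) ∂F := by
    refine integral_mono_measure hlow ?_ (iF.add (integrable_const M))
    filter_upwards [hac.ae_le hM] with x hx
    have := (abs_le.1 hx).1
    simp only [Pi.zero_apply]
    linarith
  rw [integral_smul_measure, ENNReal.toReal_ofReal (by linarith), integral_add iμ
    (integrable_const M), integral_add iF (integrable_const M)] at h1
  simp only [integral_const, smul_eq_mul] at h1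
  have h2 := measureReal_univ_le (by linarith) hup
  have h3 : ∫ x, φ x ∂μ ≤ M * μ.real univ := by
    have := integral_mono_ae iμ (integrable_const M) (by
      filter_upwards [hM] with x hx using (abs_le.1 hx).2)
    simpa [mul_comm] using this
  have h4 := mul_le_mul_of_nonneg_left h3 hδ
  have h5 := mul_le_mul_of_nonneg_left h2 hM0
  nlinarith

/-- The duality gap of the pair `(d, D)` along `S` is controlled by its gap along `T`. -/
theorem integral_gap_le {μ ν ν' F G : Measure α} [IsFiniteMeasure μ] [IsFiniteMeasure ν]
    {δ M η e : ℝ} (hδ : 0 ≤ δ) (hδ1 : δ ≤ 1) (hM0 : 0 ≤ M) (hη : 0 ≤ η)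
    (hFlow : ENNReal.ofReal (1 - δ) • μ ≤ F) (hFup : F ≤ ENNReal.ofReal (1 + δ) • μ)
    (hGlow : ENNReal.ofReal (1 - δ) • ν ≤ G) (hGup : G ≤ ENNReal.ofReal (1 + δ) • ν)
    {S T : α → α} (hS : AEMeasurable S μ) (hT : AEMeasurable T F)
    (hSμ : μ.map S = ν') (hTF : F.map T = G)
    {d D : α → ℝ} (hd : AEStronglyMeasurable d μ) (hD : StronglyMeasurable D)
    (hdM : ∀ᵐ x ∂μ, |d x| ≤ M) (hDM : ∀ᵐ x ∂ν, |D x| ≤ M) (hDM' : ∀ᵐ x ∂ν', |D x| ≤ M)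
    (hdD : ∀ᵐ x ∂μ, d x + D (T x) ≤ η) (he : ∫ y, D y ∂ν' ≤ ∫ y, D y ∂ν + e) :
    Integrable (fun x => d x + D (S x)) μ ∧
      ∫ x, (d x + D (S x)) ∂μ ≤
        (2 * η + 3 * δ * M) * μ.real univ + 3 * δ * M * ν.real univ + e := by
  have hacF : F ≪ μ := Measure.absolutelyContinuous_of_le_smul hFup
  have hacG : G ≪ ν := Measure.absolutelyContinuous_of_le_smul hGup
  have : IsFiniteMeasure F := by
    refine ⟨(hFup univ).trans_lt ?_⟩
    rw [Measure.smul_apply, smul_eq_mul]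
    exact ENNReal.mul_lt_top ENNReal.ofReal_lt_top (measure_lt_top _ _)
  have : IsFiniteMeasure G := hTF ▸ inferInstance
  have : IsFiniteMeasure ν' := hSμ ▸ inferInstance
  have iD' : Integrable D ν' := Integrable.of_bound hD.aestronglyMeasurable M hDM'
  have iDG : Integrable D G := Integrable.of_bound hD.aestronglyMeasurable M (hacG.ae_le hDM)
  have idμ : Integrable d μ := Integrable.of_bound hd M hdM
  have idF : Integrable d F := Integrable.of_bound (hd.mono_ac hacF) M (hacF.ae_le hdM)
  have iDS : Integrable (fun x => D (S x)) μ := by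
    rw [← hSμ] at iD'
    exact iD'.comp_aemeasurable hS
  have iDT : Integrable (fun x => D (T x)) F := by
    rw [← hTF] at iDG
    exact iDG.comp_aemeasurable hT
  refine ⟨idμ.add iDS, ?_⟩
  have e1 : ∫ x, D (S x) ∂μ = ∫ y, D y ∂ν' := by
    rw [← hSμ, integral_map hS hD.aestronglyMeasurable]
  have e2 : ∫ x, D (T x) ∂F = ∫ y, D y ∂G := by
    rw [← hTF, integral_map hT hD.aestronglyMeasurable]
  have h1 := integral_le_integral_add_of_smul_le hδ hδ1 hFlow hFup hd hdM hM0
  have h2 := integral_le_integral_add_of_smul_le hδ hδ1 hGlow hGup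
    hD.aestronglyMeasurable hDM hM0
  have h3 : ∫ x, (d x + D (T x)) ∂F ≤ η * F.real univ := by
    have := integral_mono_ae (idF.add iDT) (integrable_const η) (hacF.ae_le hdD)
    simpa [mul_comm] using this
  rw [integral_add idF iDT] at h3
  rw [integral_add idμ iDS]
  have h4 := mul_le_mul_of_nonneg_left (measureReal_univ_le (by linarith) hFup) hη
  have h5 : 0 ≤ η * (1 - δ) * μ.real univ :=
    mul_nonneg (mul_nonneg hη (by linarith)) measureReal_nonneg
  linarith

end Integrals

section Dilation

variable {n : ℕ}

theorem setIntegral_smul_le {C : Set (Euc n)} (hC : MeasurableSet C) {K ρ M L : ℝ} (hρ : 0 < ρ)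
    (hCK : C ⊆ ball (0 : Euc n) K) {D : Euc n → ℝ} (hDc : Continuous D)
    (hL : ∀ y y', |D y - D y'| ≤ L * ‖y - y'‖) (hL0 : 0 ≤ L)
    (hM : ∀ y ∈ C, |D (ρ • y)| ≤ M) (hM' : ∀ y ∈ C, |D y| ≤ M) :
    ∫ y in ρ • C, D y ≤ (∫ y in C, D y) +
      (|ρ ^ n - 1| * M + L * (|ρ - 1| * K)) * volume.real C := by
  have hfin : volume C ≠ ∞ := ((measure_mono hCK).trans_lt measure_ball_lt_top).ne
  have : IsFiniteMeasure (volume.restrict C) := ⟨by simpa using hfin.lt_top⟩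
  have h0 := Measure.setIntegral_comp_smul_of_pos (volume : Measure (Euc n)) D C hρ
  rw [finrank_euclideanSpace_fin, smul_eq_mul] at h0
  have h1 : ∫ y in ρ • C, D y = ρ ^ n * ∫ y in C, D (ρ • y) := by
    rw [h0, mul_inv_cancel_left₀ (pow_pos hρ n).ne']
  have iC : Integrable D (volume.restrict C) :=
    Integrable.of_bound hDc.aestronglyMeasurable M ((ae_restrict_mem hC).mono hM')
  have iρ : Integrable (fun y => D (ρ • y)) (volume.restrict C) :=
    Integrable.of_bound (hDc.comp (continuous_const_smul ρ)).aestronglyMeasurable M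
      ((ae_restrict_mem hC).mono hM)
  rw [h1, ← integral_const_mul]
  have h2 : ∫ y in C, (ρ ^ n * D (ρ • y)) ≤
      ∫ y in C, (D y + (|ρ ^ n - 1| * M + L * (|ρ - 1| * K))) := by
    refine setIntegral_mono_on (iρ.const_mul _) (iC.add (integrable_const _)) hC fun y hy => ?_
    have a1 : (ρ ^ n - 1) * D (ρ • y) ≤ |ρ ^ n - 1| * M := by
      refine (le_abs_self _).trans ?_
      rw [abs_mul]
      exact mul_le_mul_of_nonneg_left (hM y hy) (abs_nonneg _)
    have a2 := (abs_le.1 (hL (ρ • y) y)).2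
    have a3 : ‖ρ • y - y‖ ≤ |ρ - 1| * K := by
      have : ρ • y - y = (ρ - 1) • y := by rw [sub_smul, one_smul]
      rw [this, norm_smul, Real.norm_eq_abs]
      exact mul_le_mul_of_nonneg_left (mem_ball_zero_iff.1 (hCK hy)).le (abs_nonneg _)
    have a4 := mul_le_mul_of_nonneg_left a3 hL0
    linarith
  refine h2.trans (le_of_eq ?_)
  rw [integral_add iC (integrable_const _), integral_const]
  simp [mul_comm]

end Dilation
section Densities

variable {n : ℕ}

theorem withDensity_ofReal_indicator {C : Set (Euc n)} (hC : MeasurableSet C) (a : ℝ) :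
    (volume : Measure (Euc n)).withDensity
      (fun x => ENNReal.ofReal (C.indicator (fun _ => a) x)) =
      ENNReal.ofReal a • volume.restrict C := by
  have : (fun x => ENNReal.ofReal (C.indicator (fun _ => a) x)) =
      C.indicator (fun _ => ENNReal.ofReal a) := by
    ext x
    by_cases hx : x ∈ C <;> simp [hx]
  rw [this, withDensity_indicator hC, withDensity_const]

theorem withDensity_near_indicator {C : Set (Euc n)} (hC : MeasurableSet C) {f : Euc n → ℝ} {δ : ℝ}
    (hf : Function.support f ⊆ C) (h : ∀ x, |f x - C.indicator (fun _ => (1 : ℝ)) x| ≤ δ) :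
    ENNReal.ofReal (1 - δ) • (volume : Measure (Euc n)).restrict C ≤
        volume.withDensity (fun x => ENNReal.ofReal (f x)) ∧
      volume.withDensity (fun x => ENNReal.ofReal (f x)) ≤
        ENNReal.ofReal (1 + δ) • (volume : Measure (Euc n)).restrict C := by
  have h0 : ∀ x ∉ C, f x = 0 := fun x hx => by
    by_contra hne
    exact hx (hf hne)
  rw [← withDensity_ofReal_indicator hC, ← withDensity_ofReal_indicator hC]
  constructor <;> refine withDensity_mono (Eventually.of_forall fun x => ?_) <;>
    refine ENNReal.ofReal_le_ofReal ?_ <;> by_cases hx : x ∈ C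
  · have := h x
    simp only [hx, indicator_of_mem] at this ⊢
    linarith [(abs_le.1 this).1]
  · simp [hx, h0 x hx]
  · have := h x
    simp only [hx, indicator_of_mem] at this ⊢
    linarith [(abs_le.1 this).2]
  · simp [hx, h0 x hx]

theorem ae_mem_of_map_eq_restrict {α : Type*} [MeasurableSpace α] {μ : Measure α} {T : α → Euc n}
    {ν ν' : Measure (Euc n)} {C : Set (Euc n)} (hC : MeasurableSet C) (hT : AEMeasurable T μ)
    (hν : μ.map T = ν) (hac : ν ≪ ν'.restrict C) : ∀ᵐ x ∂μ, T x ∈ C := by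
  refine ae_of_ae_map hT ?_
  rw [hν]
  exact hac.ae_le (ae_restrict_mem hC)

/-- A convex function with gradient bounded by `R` almost everywhere on an open set has slopes
bounded by `R` there. -/
theorem ConvexOn.sub_le_of_ae_gradient_le {v : Euc n → ℝ} (hv : ConvexOn ℝ univ v) {R : ℝ}
    {U : Set (Euc n)} (hU : IsOpen U)
    (h : ∀ᵐ x ∂volume.restrict U, DifferentiableAt ℝ v x ∧ ‖gradient v x‖ ≤ R)
    {x : Euc n} (hx : x ∈ U) (z : Euc n) : v x - v z ≤ R * ‖x - z‖ := by
  have hcont : Continuous v := hv.locallyLipschitz.continuous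
  have hopen : IsOpen {y | R * ‖y - z‖ < v y - v z} :=
    isOpen_lt (by fun_prop) (by fun_prop)
  have hzero : volume ({y | R * ‖y - z‖ < v y - v z} ∩ U) = 0 := by
    rw [← Measure.restrict_apply hopen.measurableSet]
    refine measure_mono_null ?_ (ae_iff.1 h)
    rintro y hy ⟨hd, hg⟩
    have h1 := hv.add_inner_gradient_le hd z
    have h2 := (abs_le.1 (abs_real_inner_le_norm (z - y) (gradient v y))).1
    have h3 := mul_le_mul_of_nonneg_left hg (norm_nonneg (z - y))
    rw [norm_sub_rev z y] at h2 h3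
    have hy' : R * ‖y - z‖ < v y - v z := hy
    linarith
  rw [(hopen.inter hU).measure_eq_zero_iff volume] at hzero
  by_contra hlt
  have : x ∈ {y | R * ‖y - z‖ < v y - v z} ∩ U := ⟨not_le.1 hlt, hx⟩
  rw [hzero] at this
  exact this

end Densities

/-- The data of the compactness lemma: nearly uniform densities, a cost close to `-x⬝y`, the
potentials `u` and `v`. -/
structure IsConfig {n : ℕ} (K : ℝ) (C₁ C₂ : Set (Euc n)) (f g u v : Euc n → ℝ)
    (c : Euc n → Euc n → ℝ) (T : Euc n → Euc n) (ρ δ : ℝ) : Prop where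
  one_le : 1 ≤ K
  closed₁ : IsClosed C₁
  closed₂ : IsClosed C₂
  ball_subset₁ : ball (0 : Euc n) (1 / K) ⊆ C₁
  subset_ball₁ : C₁ ⊆ ball (0 : Euc n) K
  ball_subset₂ : ball (0 : Euc n) (1 / K) ⊆ C₂
  subset_ball₂ : C₂ ⊆ ball (0 : Euc n) K
  support_f : Function.support f ⊆ C₁
  support_g : Function.support g ⊆ C₂
  cconvex : CConvexOn C₁ (ball (0 : Euc n) K) c u
  isTu : IsTuAE c u C₁ T
  transports : TransportsTo T f g
  rho_pos : 0 < ρ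
  volume_eq : volume C₁ = volume (ρ • C₂)
  convex : ConvexOn ℝ univ v
  transports_gradient : TransportsTo (fun x => gradient v x)
    (indicator C₁ fun _ => (1 : ℝ)) (indicator (ρ • C₂) fun _ => (1 : ℝ))
  zero_eq : v 0 = u 0
  pos : 0 < δ
  f_close : ∀ x, |f x - indicator C₁ (fun _ => (1 : ℝ)) x| ≤ δ
  g_close : ∀ x, |g x - indicator C₂ (fun _ => (1 : ℝ)) x| ≤ δ
  cost : CostC2CloseOn c (ball (0 : Euc n) K ×ˢ ball (0 : Euc n) K) δ

namespace IsConfig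

variable {n : ℕ} {K : ℝ} {C₁ C₂ : Set (Euc n)} {f g u v : Euc n → ℝ}
  {c : Euc n → Euc n → ℝ} {T : Euc n → Euc n} {ρ δ : ℝ}

theorem closed_smul (h : IsConfig K C₁ C₂ f g u v c T ρ δ) : IsClosed (ρ • C₂) :=
  h.closed₂.smul_of_ne_zero h.rho_pos.ne'

theorem map_gradient (h : IsConfig K C₁ C₂ f g u v c T ρ δ) :
    (volume.restrict C₁).map (fun x => gradient v x) = volume.restrict (ρ • C₂) := by
  have := h.transports_gradient
  rw [TransportsTo, withDensity_ofReal_indicator h.closed₁.measurableSet,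
    withDensity_ofReal_indicator h.closed_smul.measurableSet] at this
  simpa using this

theorem volume_eq_mul (h : IsConfig K C₁ C₂ f g u v c T ρ δ) :
    volume C₁ = ENNReal.ofReal (ρ ^ n) * volume C₂ := by
  rw [h.volume_eq, Measure.addHaar_smul, finrank_euclideanSpace_fin,
    abs_of_pos (pow_pos h.rho_pos n)]

theorem volume_ne_top (h : IsConfig K C₁ C₂ f g u v c T ρ δ) :
    volume C₁ ≠ ∞ ∧ volume C₂ ≠ ∞ :=
  ⟨((measure_mono h.subset_ball₁).trans_lt measure_ball_lt_top).ne,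
    ((measure_mono h.subset_ball₂).trans_lt measure_ball_lt_top).ne⟩

theorem volume_pos (h : IsConfig K C₁ C₂ f g u v c T ρ δ) :
    0 < volume C₁ ∧ 0 < volume C₂ := by
  have hK := h.one_le
  have : 0 < volume (ball (0 : Euc n) (1 / K)) := measure_ball_pos _ _ (by positivity)
  exact ⟨this.trans_le (measure_mono h.ball_subset₁), this.trans_le (measure_mono h.ball_subset₂)⟩

theorem rho_le (h : IsConfig K C₁ C₂ f g u v c T ρ δ) (hn : n ≠ 0) : ρ ≤ K ^ 2 := by
  have hK := h.one_le
  have hK0 : 0 < K := by linarith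
  have h1 : volume C₁ ≤ ENNReal.ofReal ((K ^ 2) ^ n) * volume C₂ := by
    calc volume C₁ ≤ volume (ball (0 : Euc n) (K ^ 2 * (1 / K))) := by
          refine measure_mono (h.subset_ball₁.trans (ball_subset_ball (le_of_eq ?_)))
          field_simp
      _ = ENNReal.ofReal ((K ^ 2) ^ n) * volume (ball (0 : Euc n) (1 / K)) := by
          rw [Measure.addHaar_ball_mul_of_pos _ _ (by positivity), finrank_euclideanSpace_fin]
      _ ≤ _ := by gcongr; exact h.ball_subset₂
  rw [h.volume_eq_mul, ENNReal.mul_le_mul_iff_left h.volume_pos.2.ne' h.volume_ne_top.2,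
    ENNReal.ofReal_le_ofReal_iff (by positivity)] at h1
  exact le_of_pow_le_pow_left₀ hn (by positivity) h1

theorem norm_le_of_mem_smul (h : IsConfig K C₁ C₂ f g u v c T ρ δ) (hn : n ≠ 0) {y : Euc n}
    (hy : y ∈ ρ • C₂) : ‖y‖ ≤ K ^ 3 := by
  obtain ⟨w, hw, rfl⟩ := hy
  have h1 := (mem_ball_zero_iff.1 (h.subset_ball₂ hw)).le
  have h2 : ‖ρ • w‖ ≤ K ^ 2 * K := by
    rw [norm_smul, Real.norm_of_nonneg h.rho_pos.le]
    exact mul_le_mul (h.rho_le hn) h1 (norm_nonneg _) (by positivity)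
  exact h2.trans (le_of_eq (by ring))

theorem ae_gradient (h : IsConfig K C₁ C₂ f g u v c T ρ δ) :
    ∀ᵐ x ∂volume.restrict C₁, DifferentiableAt ℝ v x ∧ gradient v x ∈ ρ • C₂ :=
  (ae_restrict_of_ae h.convex.ae_differentiableAt).and
    (ae_mem_of_map_eq_restrict h.closed_smul.measurableSet (measurable_gradient v).aemeasurable
      h.map_gradient Measure.AbsolutelyContinuous.rfl)

theorem v_sub_le (h : IsConfig K C₁ C₂ f g u v c T ρ δ) (hn : n ≠ 0) {x : Euc n}
    (hx : x ∈ ball (0 : Euc n) (1 / K)) (z : Euc n) : v x - v z ≤ K ^ 3 * ‖x - z‖ := by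
  refine h.convex.sub_le_of_ae_gradient_le isOpen_ball ?_ hx z
  filter_upwards [ae_restrict_of_ae_restrict_of_subset h.ball_subset₁ h.ae_gradient] with y hy
  exact ⟨hy.1, h.norm_le_of_mem_smul hn hy.2⟩

theorem sub_lipschitz (h : IsConfig K C₁ C₂ f g u v c T ρ δ) (hn : n ≠ 0) {x z : Euc n}
    (hx : x ∈ ball (0 : Euc n) (1 / K)) (hz : z ∈ ball (0 : Euc n) (1 / K)) :
    |(u x - v x) - (u z - v z)| ≤ (K + δ + K ^ 3) * ‖x - z‖ := by
  have h1 := abs_le.1 (h.cconvex.abs_sub_le h.subset_ball₁ h.cost (h.ball_subset₁ hx)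
    (h.ball_subset₁ hz))
  have h2 := h.v_sub_le hn hx z
  have h3 := h.v_sub_le hn hz x
  rw [norm_sub_rev] at h3
  rw [abs_le]
  constructor <;> linarith

theorem density_f (h : IsConfig K C₁ C₂ f g u v c T ρ δ) :
    ENNReal.ofReal (1 - δ) • (volume : Measure (Euc n)).restrict C₁ ≤
        volume.withDensity (fun x => ENNReal.ofReal (f x)) ∧
      volume.withDensity (fun x => ENNReal.ofReal (f x)) ≤
        ENNReal.ofReal (1 + δ) • (volume : Measure (Euc n)).restrict C₁ :=
  withDensity_near_indicator h.closed₁.measurableSet h.support_f h.f_close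

theorem density_g (h : IsConfig K C₁ C₂ f g u v c T ρ δ) :
    ENNReal.ofReal (1 - δ) • (volume : Measure (Euc n)).restrict C₂ ≤
        volume.withDensity (fun x => ENNReal.ofReal (g x)) ∧
      volume.withDensity (fun x => ENNReal.ofReal (g x)) ≤
        ENNReal.ofReal (1 + δ) • (volume : Measure (Euc n)).restrict C₂ :=
  withDensity_near_indicator h.closed₂.measurableSet h.support_g h.g_close

theorem absolutelyContinuous_f (h : IsConfig K C₁ C₂ f g u v c T ρ δ) (hδ : δ ≤ 1 / 2) :
    volume.restrict C₁ ≪ volume.withDensity (fun x => ENNReal.ofReal (f x)) := by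
  refine (Measure.absolutelyContinuous_smul (c := ENNReal.ofReal (1 - δ)) ?_).trans
    (Measure.absolutelyContinuous_of_le h.density_f.1)
  simp only [ne_eq, ENNReal.ofReal_eq_zero, not_le]
  linarith

theorem aemeasurable (h : IsConfig K C₁ C₂ f g u v c T ρ δ) (hδ : δ ≤ 1 / 2) :
    AEMeasurable T (volume.withDensity (fun x => ENNReal.ofReal (f x))) := by
  refine AEMeasurable.of_map_ne_zero ?_
  rw [h.transports]
  intro h0
  have h1 := h.density_g.1 univ
  rw [h0, Measure.smul_apply, Measure.restrict_apply_univ, smul_eq_mul] at h1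
  simp only [Measure.coe_zero, Pi.zero_apply, nonpos_iff_eq_zero, mul_eq_zero,
    ENNReal.ofReal_eq_zero, h.volume_pos.2.ne', or_false] at h1
  linarith

theorem ae_approxSubgrad (h : IsConfig K C₁ C₂ f g u v c T ρ δ) (hδ : δ ≤ 1 / 2) :
    ∀ᵐ x ∂volume.restrict C₁, ApproxSubgrad u C₁ x (T x) (4 * K * δ + 2 * δ) := by
  have hT : ∀ᵐ x ∂volume.restrict C₁, T x ∈ C₂ :=
    (h.absolutelyContinuous_f hδ).ae_le (ae_mem_of_map_eq_restrict h.closed₂.measurableSet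
      (h.aemeasurable hδ) h.transports (Measure.absolutelyContinuous_of_le_smul h.density_g.2))
  filter_upwards [hT, h.isTu, ae_fullTangent h.closed₁.measurableSet volume,
    ae_restrict_mem h.closed₁.measurableSet] with x hx1 hx2 hx3 hx4
  exact h.cconvex.approxSubgrad_of_gradient h.subset_ball₁ h.cost h.pos.le hx4 hx3
    (h.subset_ball₂ hx1) hx2.1 hx2.2

theorem abs_rho_pow_sub_one_le (h : IsConfig K C₁ C₂ f g u v c T ρ δ) (hδ : δ ≤ 1 / 2) :
    |ρ ^ n - 1| ≤ 4 * δ := by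
  have hpos := h.pos
  have htot : volume.withDensity (fun x => ENNReal.ofReal (f x)) univ =
      volume.withDensity (fun x => ENNReal.ofReal (g x)) univ := by
    rw [← h.transports, Measure.map_apply_of_aemeasurable (h.aemeasurable hδ) .univ, preimage_univ]
  have h1 := (h.density_f.1 univ).trans (htot.le.trans (h.density_g.2 univ))
  have h2 := (h.density_g.1 univ).trans (htot.ge.trans (h.density_f.2 univ))
  have hρ := pow_pos h.rho_pos n
  simp only [Measure.smul_apply, Measure.restrict_apply_univ, smul_eq_mul, h.volume_eq_mul,
    ← mul_assoc] at h1 h2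
  rw [ENNReal.mul_le_mul_iff_left h.volume_pos.2.ne' h.volume_ne_top.2,
    ← ENNReal.ofReal_mul (by linarith), ENNReal.ofReal_le_ofReal_iff (by linarith)] at h1
  rw [ENNReal.mul_le_mul_iff_left h.volume_pos.2.ne' h.volume_ne_top.2,
    ← ENNReal.ofReal_mul (by linarith), ENNReal.ofReal_le_ofReal_iff (by nlinarith)] at h2
  rw [abs_le]
  constructor <;> nlinarith

theorem abs_rho_sub_one_le (h : IsConfig K C₁ C₂ f g u v c T ρ δ) (hn : n ≠ 0) (hδ : δ ≤ 1 / 2) :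
    |ρ - 1| ≤ 4 * δ := by
  have h1 := abs_le.1 (h.abs_rho_pow_sub_one_le hδ)
  rw [abs_le]
  rcases le_total 1 ρ with h2 | h2
  · have := le_self_pow₀ h2 hn
    constructor <;> linarith [h.pos]
  · have := pow_le_of_le_one h.rho_pos.le h2 hn
    constructor <;> linarith [h.pos]

/-- A constant bounding the optimality gap of the potential `u` along `∇v`. -/
def gapConst (n : ℕ) (K : ℝ) : ℝ :=
  (8 * K + 4 + 80 * K ^ 4 + 8 * K ^ 2) * volume.real (ball (0 : Euc n) K)

/-- The gradient of `v` is on average an almost exact subgradient of `u`. -/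
theorem exists_gap (h : IsConfig K C₁ C₂ f g u v c T ρ δ) (hn : n ≠ 0) (hδ : δ ≤ 1 / 2) :
    ∃ (E : Euc n → ℝ) (G : Set (Euc n)), (∀ᵐ x ∂volume.restrict C₁, x ∈ G) ∧
      Integrable E (volume.restrict C₁) ∧ ∫ x in C₁, E x ≤ gapConst n K * δ ∧
      ∀ x ∈ G, 0 ≤ E x ∧ ‖gradient v x‖ ≤ K ^ 3 ∧ ApproxSubgrad u G x (gradient v x) (E x) ∧
        ApproxSubgrad v G x (gradient v x) 0 := by
  have hK := h.one_le
  have hpos := h.pos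
  have hK24 : K ^ 2 ≤ K ^ 4 := pow_le_pow_right₀ hK (by norm_num)
  have hK12 : K ≤ K ^ 2 := by nlinarith
  have hK13 : K ≤ K ^ 3 := le_self_pow₀ hK (by norm_num)
  have hmem0 : (0 : Euc n) ∈ ball (0 : Euc n) (1 / K) := mem_ball_self (by positivity)
  set η : ℝ := 4 * K * δ + 2 * δ with hη
  set G : Set (Euc n) := {x | x ∈ C₁ ∧ (DifferentiableAt ℝ v x ∧ gradient v x ∈ ρ • C₂) ∧
    ApproxSubgrad u C₁ x (T x) η} with hG
  have hGae : ∀ᵐ x ∂volume.restrict C₁, x ∈ G :=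
    (ae_restrict_mem h.closed₁.measurableSet).and (h.ae_gradient.and (h.ae_approxSubgrad hδ))
  have : NeZero (volume.restrict C₁) := ⟨by
    rw [ne_eq, Measure.restrict_eq_zero]
    exact h.volume_pos.1.ne'⟩
  have hGne : G.Nonempty := hGae.exists
  have hGK : ∀ z ∈ G, ‖z‖ ≤ K := fun z hz => (mem_ball_zero_iff.1 (h.subset_ball₁ hz.1)).le
  set u' : Euc n → ℝ := fun z => u z - u 0 with hu'
  set v' : Euc n → ℝ := fun z => v z - v 0 with hv'
  have hsub : ∀ x ∈ G, ∀ z, v x + ⟪z - x, gradient v x⟫ ≤ v z :=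
    fun x hx z => h.convex.add_inner_gradient_le hx.2.1.1 z
  have hgn : ∀ x ∈ G, ‖gradient v x‖ ≤ K ^ 3 := fun x hx => h.norm_le_of_mem_smul hn hx.2.1.2
  have hWu : ∀ z ∈ G, |u' z| ≤ 2 * K ^ 4 := by
    intro z hz
    have h1 := h.cconvex.abs_sub_le h.subset_ball₁ h.cost hz.1 (h.ball_subset₁ hmem0)
    rw [sub_zero] at h1
    have h2 : (K + δ) * ‖z‖ ≤ (2 * K) * K :=
      mul_le_mul (by linarith) (hGK z hz) (norm_nonneg _) (by linarith)
    calc |u z - u 0| ≤ _ := h1.trans h2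
      _ ≤ 2 * K ^ 4 := by nlinarith
  have hWv : ∀ z ∈ G, |v' z| ≤ 2 * K ^ 4 := by
    intro z hz
    have h1 := h.v_sub_le hn hmem0 z
    have h2 := hsub z hz 0
    have h3 := (abs_le.1 (abs_real_inner_le_norm (0 - z) (gradient v z))).1
    have h4 := mul_le_mul_of_nonneg_left (hgn z hz) (norm_nonneg (0 - z))
    have h5 : ‖0 - z‖ ≤ K := by simpa using hGK z hz
    have h6 := mul_le_mul_of_nonneg_left h5 (show 0 ≤ K ^ 3 by positivity)
    have h7 : K ^ 3 * K = K ^ 4 := by ring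
    have h8 : 0 ≤ K ^ 4 := by positivity
    simp only [hv']
    rw [abs_le]
    constructor <;> linarith
  set D : Euc n → ℝ := fun y => relConj G u' y - relConj G v' y with hD
  set d : Euc n → ℝ := fun x => u' x - v' x with hd
  have hDL : ∀ y y', |D y - D y'| ≤ 2 * K * ‖y - y'‖ := by
    intro y y'
    have h1 := abs_le.1 (abs_relConj_sub_le hGne hGK hWu y y')
    have h2 := abs_le.1 (abs_relConj_sub_le hGne hGK hWv y y')
    simp only [hD]
    rw [abs_le]
    constructor <;> linarith
  have hDc : Continuous D := by
    have hl : LipschitzWith (2 * K).toNNReal D := LipschitzWith.of_dist_le_mul fun y y' => by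
      rw [Real.dist_eq, dist_eq_norm, Real.coe_toNNReal _ (by positivity)]
      exact hDL y y'
    exact hl.continuous
  have hDM : ∀ y, ‖y‖ ≤ K ^ 3 → |D y| ≤ 8 * K ^ 4 := by
    intro y hy
    have h1 := abs_le.1 (abs_relConj_le hGne hGK hWu y)
    have h2 := abs_le.1 (abs_relConj_le hGne hGK hWv y)
    have h3 := mul_le_mul_of_nonneg_left hy (show 0 ≤ K by positivity)
    have h4 : K * K ^ 3 = K ^ 4 := by ring
    simp only [hD]
    rw [abs_le]
    constructor <;> linarith
  have hC2M : ∀ y ∈ C₂, |D y| ≤ 8 * K ^ 4 := fun y hy =>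
    hDM y ((mem_ball_zero_iff.1 (h.subset_ball₂ hy)).le.trans hK13)
  have hC2M' : ∀ y ∈ ρ • C₂, |D y| ≤ 8 * K ^ 4 := fun y hy => hDM y (h.norm_le_of_mem_smul hn hy)
  have hdM : ∀ x ∈ G, |d x| ≤ 8 * K ^ 4 := by
    intro x hx
    have h1 := hWu x hx
    have h2 := hWv x hx
    have h3 : 0 ≤ K ^ 4 := by positivity
    have h4 := abs_sub (u' x) (v' x)
    simp only [hd]
    linarith
  have hvS : ∀ x ∈ G, v' x + relConj G v' (gradient v x) = ⟪x, gradient v x⟫ := by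
    intro x hx
    have h1 := le_relConj hGK hWv (gradient v x) hx
    have h2 : relConj G v' (gradient v x) ≤ ⟪x, gradient v x⟫ - v' x := by
      refine relConj_le hGne fun z hz => ?_
      have := hsub x hx z
      rw [inner_sub_left] at this
      simp only [hv']
      linarith
    linarith
  have huT : ∀ x ∈ G, d x + D (T x) ≤ η := by
    intro x hx
    have h1 := le_relConj hGK hWv (T x) hx
    have h2 : relConj G u' (T x) ≤ ⟪x, T x⟫ - u' x + η := by
      refine relConj_le hGne fun z hz => ?_
      have := hx.2.2 z hz.1
      rw [inner_sub_left] at this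
      simp only [hu']
      linarith
    simp only [hd, hD]
    linarith
  have huc : ContinuousOn u C₁ := by
    have hl : LipschitzOnWith (K + δ).toNNReal u C₁ :=
      LipschitzOnWith.of_dist_le_mul fun y hy y' hy' => by
        rw [Real.dist_eq, dist_eq_norm, Real.coe_toNNReal _ (by positivity)]
        exact h.cconvex.abs_sub_le h.subset_ball₁ h.cost hy hy'
    exact hl.continuousOn
  have hdm : AEStronglyMeasurable d (volume.restrict C₁) := by
    have hvc : Continuous v := h.convex.locallyLipschitz.continuous
    refine ContinuousOn.aestronglyMeasurable ?_ h.closed₁.measurableSet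
    exact (huc.sub continuousOn_const).sub (hvc.continuousOn.sub continuousOn_const)
  have : IsFiniteMeasure (volume.restrict C₁) := ⟨by simpa using h.volume_ne_top.1.lt_top⟩
  have : IsFiniteMeasure (volume.restrict C₂) := ⟨by simpa using h.volume_ne_top.2.lt_top⟩
  have hdil := setIntegral_smul_le h.closed₂.measurableSet h.rho_pos h.subset_ball₂ hDc hDL
    (by positivity) (fun y hy => hC2M' _ (smul_mem_smul_set hy)) hC2M
  obtain ⟨hint, hle⟩ := integral_gap_le h.pos.le (by linarith) (by positivity) (by positivity)
    h.density_f.1 h.density_f.2 h.density_g.1 h.density_g.2 (measurable_gradient v).aemeasurable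
    (h.aemeasurable hδ) h.map_gradient h.transports hdm hDc.stronglyMeasurable
    (hGae.mono hdM) ((ae_restrict_mem h.closed₂.measurableSet).mono hC2M)
    ((ae_restrict_mem h.closed_smul.measurableSet).mono hC2M') (hGae.mono huT) hdil
  refine ⟨fun x => d x + D (gradient v x), G, hGae, hint, hle.trans ?_, fun x hx =>
    ⟨?_, hgn x hx, fun z hz => ?_, fun z _ => by linarith [hsub x hx z]⟩⟩
  · rw [measureReal_restrict_apply_univ, measureReal_restrict_apply_univ, gapConst]
    have hV : ∀ C ⊆ ball (0 : Euc n) K, volume.real C ≤ volume.real (ball (0 : Euc n) K) :=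
      fun C hC => measureReal_mono hC measure_ball_lt_top.ne
    have hV1 := hV C₁ h.subset_ball₁
    have hV2 := hV C₂ h.subset_ball₂
    have h1 := h.abs_rho_pow_sub_one_le hδ
    have h2 := h.abs_rho_sub_one_le hn hδ
    have h3 : |ρ ^ n - 1| * (8 * K ^ 4) + 2 * K * (|ρ - 1| * K) ≤
        4 * δ * (8 * K ^ 4) + 2 * K * (4 * δ * K) := by gcongr
    calc _ ≤ (2 * η + 3 * δ * (8 * K ^ 4)) * volume.real (ball (0 : Euc n) K) +
          3 * δ * (8 * K ^ 4) * volume.real (ball (0 : Euc n) K) +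
          (4 * δ * (8 * K ^ 4) + 2 * K * (4 * δ * K)) * volume.real (ball (0 : Euc n) K) := by
          gcongr
      _ = _ := by rw [hη]; ring
  · have h1 := le_relConj hGK hWu (gradient v x) hx
    have h2 := hvS x hx
    simp only [hd, hD]
    linarith
  · have h1 := le_relConj hGK hWu (gradient v x) hz
    have h2 := hvS x hx
    rw [inner_sub_left]
    simp only [hd, hD, hu'] at h1 h2 ⊢
    linarith

theorem abs_sub_le_of_small (h : IsConfig K C₁ C₂ f g u v c T ρ δ) (hn : n ≠ 0) (hδ : δ ≤ 1 / 2)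
    {r s : ℝ} {N : ℕ} (hN : 0 < N) (hr : 0 < r) (hrK : r * K < 1) (hs : 0 < s)
    (hsmall : (N + 1) * (gapConst n K * δ / s) < volume.real (ball (0 : Euc n) r))
    {x : Euc n} (hx : x ∈ ball (0 : Euc n) (1 / K)) :
    |u x - v x| ≤ 3 * (K + 1 + K ^ 3) * r + 2 * K ^ 3 / N + N * s := by
  have hK := h.one_le
  have hpos := h.pos
  obtain ⟨E, G, hG, hE, hEle, hGE⟩ := h.exists_gap hn hδ
  have hmeas : volume (ball (0 : Euc n) (1 / K) \ (G ∩ {x | E x ≤ s})) ≤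
      ENNReal.ofReal (gapConst n K * δ / s) := by
    calc _ ≤ volume.restrict C₁ (Gᶜ ∪ {x | s ≤ E x}) := by
          refine (measure_mono ?_).trans (Measure.le_restrict_apply C₁ _)
          rintro y ⟨hy, hy'⟩
          refine ⟨?_, h.ball_subset₁ hy⟩
          by_contra hcon
          rw [mem_union, not_or] at hcon
          have hlt : E y < s := not_le.1 hcon.2
          exact hy' ⟨not_not.1 hcon.1, hlt.le⟩
      _ ≤ volume.restrict C₁ Gᶜ + volume.restrict C₁ {x | s ≤ E x} := measure_union_le _ _
      _ = volume.restrict C₁ {x | s ≤ E x} := by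
          rw [show volume.restrict C₁ Gᶜ = 0 from hG, zero_add]
      _ ≤ _ := by
          have : IsFiniteMeasure (volume.restrict C₁) :=
            ⟨by simpa using h.volume_ne_top.1.lt_top⟩
          have h1 := mul_meas_ge_le_integral_of_nonneg (hG.mono fun y hy => (hGE y hy).1) hE s
          rw [← ENNReal.ofReal_toReal (measure_ne_top (volume.restrict C₁) {x | s ≤ E x})]
          refine ENNReal.ofReal_le_ofReal ?_
          rw [le_div_iff₀ hs, mul_comm]
          exact h1.trans hEle
  have hA : ((N + 1 : ℕ) : ℝ≥0∞) * volume (ball (0 : Euc n) (1 / K) \ (G ∩ {x | E x ≤ s})) <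
      volume (ball (0 : Euc n) r) := by
    refine (mul_le_mul_right hmeas _).trans_lt ?_
    rw [← ENNReal.ofReal_natCast, ← ENNReal.ofReal_mul (Nat.cast_nonneg _),
      ← ENNReal.ofReal_toReal (measure_ball_lt_top (μ := volume) (x := (0 : Euc n)) (r := r)).ne]
    refine (ENNReal.ofReal_lt_ofReal_iff ?_).2 (by push_cast; exact hsmall)
    exact ENNReal.toReal_pos (measure_ball_pos _ _ hr).ne' measure_ball_lt_top.ne
  have key := abs_sub_le_of_common_subgrad (u := u) (v := v) (S := fun x => gradient v x)
    (A := G ∩ {x | E x ≤ s}) (R := K ^ 3) (L := K + 1 + K ^ 3) (s := s) hK hN hr hrK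
    (fun y hy z hz => by
      have := (hGE y hy.1).2.2.1 z hz.1
      have hy2 : E y ≤ s := hy.2
      linarith)
    (fun y hy z hz => (hGE y hy.1).2.2.2 z hz.1) (fun y hy => (hGE y hy.1).2.1)
    (fun y hy z hz => (h.sub_lipschitz hn hy hz).trans
      (mul_le_mul_of_nonneg_right (by linarith) (norm_nonneg _)))
    (by positivity) (by positivity) hA hx
  rwa [h.zero_eq, sub_self, sub_zero] at key

theorem abs_sub_le (h : IsConfig K C₁ C₂ f g u v c T ρ δ) {x : Euc n}
    (hx : x ∈ ball (0 : Euc n) (1 / K)) : |u x - v x| ≤ K + δ + K ^ 3 := by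
  have hK := h.one_le
  have hpos := h.pos
  rcases eq_or_ne n 0 with rfl | hn
  · rw [Subsingleton.elim x 0, h.zero_eq, sub_self, abs_zero]
    positivity
  · have h1 := h.sub_lipschitz hn hx (mem_ball_self (by positivity))
    rw [h.zero_eq, sub_self, sub_zero, sub_zero] at h1
    refine h1.trans (mul_le_of_le_one_right (by positivity) ?_)
    exact (mem_ball_zero_iff.1 hx).le.trans (div_le_one_of_le₀ hK (by positivity))

theorem exists_delta (n : ℕ) {K : ℝ} (hK : 1 ≤ K) {ε : ℝ} (hε : 0 < ε) :
    ∃ δ₀ > 0, ∀ (C₁ C₂ : Set (Euc n)) (f g u v : Euc n → ℝ) (c : Euc n → Euc n → ℝ)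
      (T : Euc n → Euc n) (ρ δ : ℝ), IsConfig K C₁ C₂ f g u v c T ρ δ → δ ≤ δ₀ →
      ∀ x ∈ ball (0 : Euc n) (1 / K), |u x - v x| ≤ ε := by
  rcases eq_or_ne n 0 with rfl | hn
  · refine ⟨1, one_pos, fun C₁ C₂ f g u v c T ρ δ h _ x _ => ?_⟩
    rw [Subsingleton.elim x 0, h.zero_eq, sub_self, abs_zero]
    exact hε.le
  have hK0 : 0 < K := by linarith
  set L : ℝ := K + 1 + K ^ 3 with hL
  have hL0 : 0 < L := by positivity
  obtain ⟨r, hr, hrL, hrK⟩ : ∃ r > 0, 3 * L * r ≤ ε / 3 ∧ r * K < 1 := by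
    refine ⟨min (ε / (9 * L)) (1 / (2 * K)), by positivity, ?_, ?_⟩
    · calc 3 * L * min (ε / (9 * L)) (1 / (2 * K)) ≤ 3 * L * (ε / (9 * L)) := by
            gcongr; exact min_le_left _ _
        _ = ε / 3 := by field_simp; norm_num
    · calc min (ε / (9 * L)) (1 / (2 * K)) * K ≤ 1 / (2 * K) * K := by
            gcongr; exact min_le_right _ _
        _ = 1 / 2 := by field_simp
        _ < 1 := by norm_num
  obtain ⟨N, hN, hNε⟩ : ∃ N : ℕ, 0 < N ∧ 2 * K ^ 3 / N ≤ ε / 3 := by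
    obtain ⟨N, hN⟩ := exists_nat_gt (2 * K ^ 3 / (ε / 3))
    have hN0 : (0 : ℝ) < N := lt_trans (by positivity) hN
    refine ⟨N, by exact_mod_cast hN0, ?_⟩
    rw [div_lt_iff₀ (by positivity)] at hN
    rw [div_le_iff₀ hN0]
    linarith
  have hN0 : (0 : ℝ) < N := by exact_mod_cast hN
  set s : ℝ := ε / (3 * N) with hs
  have hs0 : 0 < s := by positivity
  have hNs : N * s = ε / 3 := by rw [hs]; field_simp
  have hV : 0 < volume.real (ball (0 : Euc n) r) :=
    ENNReal.toReal_pos (measure_ball_pos _ _ hr).ne' measure_ball_lt_top.ne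
  have hgc : 0 ≤ gapConst n K := by rw [gapConst]; positivity
  set B : ℝ := (N + 1) * ((gapConst n K + 1) / s) with hB
  have hB0 : 0 < B := by positivity
  refine ⟨min (1 / 2) (volume.real (ball (0 : Euc n) r) / (2 * B)), by positivity,
    fun C₁ C₂ f g u v c T ρ δ h hδ x hx => ?_⟩
  have hpos := h.pos
  have hδ2 := hδ.trans (min_le_right _ _)
  refine (h.abs_sub_le_of_small hn (hδ.trans (min_le_left _ _)) hN hr hrK hs0 ?_ hx).trans
    (by linarith)
  calc (N + 1) * (gapConst n K * δ / s) ≤ (N + 1) * ((gapConst n K + 1) * δ / s) := by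
        gcongr; linarith
    _ = B * δ := by rw [hB]; ring
    _ ≤ B * (volume.real (ball (0 : Euc n) r) / (2 * B)) := by gcongr
    _ = volume.real (ball (0 : Euc n) r) / 2 := by field_simp
    _ < _ := half_lt_self hV

end IsConfig

/-- Lemma 4.1, compactness: if the densities are `δ`-close to indicator
functions and the cost is `δ`-close to `-x⬝y`, then `u` is `ω(δ)`-close in `C⁰(B_{1/K})` to
the convex potential `v` of the optimal transport for the linear cost. -/
theorem compactness_lemma
    (n : ℕ) (K : ℝ) (hK : 1 ≤ K) :
    ∃ ω : ℝ → ℝ,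
      (∀ s t : ℝ, 0 < s → s ≤ t → ω s ≤ ω t) ∧
      (∀ δ > (0 : ℝ), δ ≤ ω δ) ∧
      Filter.Tendsto ω (nhdsWithin 0 (Set.Ioi 0)) (nhds 0) ∧
      ∀ (C₁ C₂ : Set (Euc n)) (f g u v : Euc n → ℝ) (c : Euc n → Euc n → ℝ)
        (T : Euc n → Euc n) (ρ δ : ℝ),
        IsClosed C₁ → IsClosed C₂ →
        ball (0 : Euc n) (1 / K) ⊆ C₁ → C₁ ⊆ ball (0 : Euc n) K →
        ball (0 : Euc n) (1 / K) ⊆ C₂ → C₂ ⊆ ball (0 : Euc n) K →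
        Function.support f ⊆ C₁ → Function.support g ⊆ C₂ →
        CConvexOn C₁ (ball (0 : Euc n) K) c u →
        (∀ x ∈ C₁, cSubdiff C₁ (closure (ball (0 : Euc n) K)) c u x ⊆ ball (0 : Euc n) K) →
        IsTuAE c u C₁ T → TransportsTo T f g →
        0 < ρ → volume C₁ = volume (ρ • C₂) →
        ConvexOn ℝ Set.univ v →
        TransportsTo (fun x => gradient v x)
          (Set.indicator C₁ fun _ => (1 : ℝ)) (Set.indicator (ρ • C₂) fun _ => (1 : ℝ)) →
        v 0 = u 0 →
        0 < δ →
        (∃ a b : ℝ, (∀ x, |f x - Set.indicator C₁ (fun _ => (1 : ℝ)) x| ≤ a) ∧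
          (∀ x, |g x - Set.indicator C₂ (fun _ => (1 : ℝ)) x| ≤ b) ∧ a + b ≤ δ) →
        CostC2CloseOn c (ball (0 : Euc n) K ×ˢ ball (0 : Euc n) K) δ →
        ∀ x ∈ ball (0 : Euc n) (1 / K), |u x - v x| ≤ ω δ := by
  obtain ⟨ω, h1, h2, h3, h4⟩ := exists_modulus
    (fun δ t => ∃ (C₁ C₂ : Set (Euc n)) (f g u v : Euc n → ℝ) (c : Euc n → Euc n → ℝ)
      (T : Euc n → Euc n) (ρ : ℝ), IsConfig K C₁ C₂ f g u v c T ρ δ ∧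
      ∃ x ∈ ball (0 : Euc n) (1 / K), t = |u x - v x|)
    (fun δ _ => ⟨K + δ + K ^ 3, by
      rintro δ' _ _ hδ' ⟨C₁, C₂, f, g, u, v, c, T, ρ, h, x, hx, rfl⟩
      linarith [h.abs_sub_le hx]⟩)
    (fun ε hε => by
      obtain ⟨δ₀, hδ₀, H⟩ := IsConfig.exists_delta n hK hε
      refine ⟨δ₀, hδ₀, ?_⟩
      rintro δ' _ _ hδ' ⟨C₁, C₂, f, g, u, v, c, T, ρ, h, x, hx, rfl⟩
      exact H C₁ C₂ f g u v c T ρ δ' h hδ' x hx)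
  refine ⟨ω, h1, h2, h3, ?_⟩
  intro C₁ C₂ f g u v c T ρ δ hC₁ hC₂ hb₁ hs₁ hb₂ hs₂ hf hg hu _ hT hTr hρ hvol hv hvT h0 hδ hab
    hc x hx
  obtain ⟨a, b, ha, hb, hab⟩ := hab
  have ha0 : 0 ≤ a := (abs_nonneg _).trans (ha 0)
  have hb0 : 0 ≤ b := (abs_nonneg _).trans (hb 0)
  exact h4 δ _ hδ ⟨C₁, C₂, f, g, u, v, c, T, ρ, ⟨hK, hC₁, hC₂, hb₁, hs₁, hb₂, hs₂, hf, hg, hu, hT,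
    hTr, hρ, hvol, hv, hvT, h0, hδ, fun y => (ha y).trans (by linarith),
    fun y => (hb y).trans (by linarith), hc⟩, x, hx, rfl⟩
end
end

section
/- Let u and v be, respectively, a c-convex function and a convex function defined on a domain containing the ellipsoid E(x₀,h) := {x ∈ ℝ^n : D(x−x₀)·(x−x₀) ≤ h}, where D is a symmetric n×n matrix satisfying Id/K ≤ D ≤ K·Id for some K ≥ 1 and h > 0. Assume there exist constants ε, δ > 0 such that ‖v − u‖_{C⁰(E(x₀,h))} ≤ ε and ‖c(x,y) + x·y‖_{C²(E(x₀,h) × ∂_c u(E(x₀,h)))} ≤ δ. Then there exists a constant K′ depending only on n and K such that, for all 0 < ε < h² ≤ 1, ∂_c u(E(x₀, h − √ε)) ⊂ N_{K′(δ + √(hε))}( ∂⁻v(E(x₀,h)) ), where ∂⁻v denotes the (convex, i.e. Frechet) subdifferential of v. -/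
open MeasureTheory Metric Set Filter Asymptotics
open scoped ENNReal NNReal RealInnerProductSpace Pointwise Topology

noncomputable section

/-- Touching `v` from below by a differentiable function gives a Frechet subgradient. -/
theorem HasGradientAt.mem_frechetSubdiff {n : ℕ} {v φ : Euc n → ℝ} {p z : Euc n}
    (hφ : HasGradientAt φ p z) (hmin : IsLocalMin (fun w => v w - φ w) z) :
    p ∈ frechetSubdiff v z := by
  intro ε hε
  have hlit := (hasGradientAt_iff_isLittleO.1 hφ).def hε
  filter_upwards [hlit, hmin] with w hw hm
  have := (abs_le.1 hw).1
  linarith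

/-- A ball of radius `s / (2 √(h K))` around a point of the ellipsoid of level `h - s` is contained
in the ellipsoid of level `h`. -/
theorem inner_map_add_le {n : ℕ} {D : Euc n →L[ℝ] Euc n} {K h s : ℝ} {ξ w : Euc n}
    (hD : IsSelfAdjoint D) (hpos : ∀ η : Euc n, 0 ≤ ⟪D η, η⟫)
    (hK : ⟪D w, w⟫ ≤ K * ‖w‖ ^ 2) (hh : 0 < h) (hs : 0 < s)
    (hξ : ⟪D ξ, ξ⟫ ≤ h - s) (hw : 4 * h * (K * ‖w‖ ^ 2) ≤ s ^ 2) :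
    ⟪D (ξ + w), ξ + w⟫ ≤ h := by
  have hsymm : ⟪D w, ξ⟫ = ⟪D ξ, w⟫ := by
    rw [real_inner_comm]
    exact (hD.isSymmetric ξ w).symm
  have hsq := hpos (s • ξ - (2 * h) • w)
  simp only [map_add, map_sub, map_smul, inner_add_left, inner_add_right, inner_sub_left,
    inner_sub_right, real_inner_smul_left, real_inner_smul_right, hsymm] at hsq ⊢
  have hW : 4 * h * ⟪D w, w⟫ ≤ s ^ 2 := (mul_le_mul_of_nonneg_left hK (by positivity)).trans hw
  have hcross : 4 * h * s * ⟪D ξ, w⟫ ≤ s ^ 2 * ⟪D ξ, ξ⟫ + 4 * h ^ 2 * ⟪D w, w⟫ := by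
    linarith
  have h1 := mul_le_mul_of_nonneg_left hξ (by positivity : 0 ≤ 2 * h * s + s ^ 2)
  have h2 := mul_le_mul_of_nonneg_left hW (by positivity : 0 ≤ 2 * h + s)
  have h3 : 2 * h * s * (⟪D ξ, ξ⟫ + 2 * ⟪D ξ, w⟫ + ⟪D w, w⟫) ≤ 2 * h * s * h := by
    nlinarith [pow_pos hs 3]
  linarith [le_of_mul_le_mul_left h3 (by positivity)]

/-- The partial gradient in `x` of a cost close to `-x ⬝ y` is close to `-y`. -/
theorem CostC2CloseOn.exists_hasGradientAt {n : ℕ} {c : Euc n → Euc n → ℝ}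
    {S : Set (Euc n × Euc n)} {δ : ℝ} (hc : CostC2CloseOn c S δ) {z y : Euc n}
    (hzy : (z, y) ∈ S) :
    ∃ g : Euc n, ‖g‖ ≤ δ ∧ HasGradientAt (fun w => c w y) (g - y) z := by
  obtain ⟨hdiff, -, hle, -⟩ := hc _ hzy
  have hG : HasFDerivAt (fun q : Euc n × Euc n => c q.1 q.2 + ⟪q.1, q.2⟫) _ (z, y) :=
    ((hdiff.differentiableAt (by norm_num)).add
      (differentiableAt_fst.inner ℝ differentiableAt_snd)).hasFDerivAt
  set L := fderiv ℝ (fun q : Euc n × Euc n => c q.1 q.2 + ⟪q.1, q.2⟫) (z, y)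
  have hLz := HasFDerivAt.comp (f := fun w => (w, y)) z hG (hasFDerivAt_prodMk_left (𝕜 := ℝ) z y)
  refine ⟨(InnerProductSpace.toDual ℝ (Euc n)).symm (L.comp (.inl ℝ (Euc n) (Euc n))), ?_, ?_⟩
  · rw [LinearIsometryEquiv.norm_map]
    refine (L.comp _).opNorm_le_bound ((norm_nonneg _).trans hle) fun w => ?_
    refine ((L.le_opNorm _).trans (mul_le_mul_of_nonneg_right hle (norm_nonneg _))).trans ?_
    simp [Prod.norm_def]
  · rw [hasGradientAt_iff_hasFDerivAt, map_sub, LinearIsometryEquiv.apply_symm_apply]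
    refine (hLz.sub (InnerProductSpace.toDual ℝ (Euc n) y).hasFDerivAt).congr_of_eventuallyEq ?_
    refine .of_forall fun w => ?_
    simp [real_inner_comm]

/-- If `v` stays above a differentiable function `φ` up to `ε` on a closed ball and is at most
`φ + ε` at its center, then it has a Frechet subgradient in the ball which is close to the gradient
of `φ` at the same point. -/
theorem exists_mem_frechetSubdiff_norm_sub_le {n : ℕ} {v φ : Euc n → ℝ} {x : Euc n} {ε r : ℝ}
    {φ' : Euc n → Euc n} (hε : 0 < ε) (hr : 0 < r) (hv : ContinuousOn v (closedBall x r))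
    (hφ : ∀ z ∈ closedBall x r, HasGradientAt φ (φ' z) z)
    (hle : ∀ z ∈ closedBall x r, φ z - ε ≤ v z) (hx : v x ≤ φ x + ε) :
    ∃ z ∈ closedBall x r, ∃ p ∈ frechetSubdiff v z, ‖φ' z - p‖ ≤ 6 * ε / r := by
  set a := 3 * ε / r ^ 2 with ha
  have hcont : ContinuousOn (fun w => v w - (φ w - a * ‖w - x‖ ^ 2)) (closedBall x r) :=
    hv.sub (ContinuousOn.sub (fun z hz => (hφ z hz).continuousAt.continuousWithinAt)
      (by fun_prop))
  obtain ⟨z, hz, hmin⟩ := (isCompact_closedBall x r).exists_isMinOn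
    (nonempty_closedBall.2 hr.le) hcont
  have hzr : ‖z - x‖ ≤ r := by simpa [dist_eq_norm] using hz
  have hlt : ‖z - x‖ < r := by
    refine lt_of_le_of_ne hzr fun heq => ?_
    have h1 : v z - (φ z - a * ‖z - x‖ ^ 2) ≤ v x - (φ x - a * ‖x - x‖ ^ 2) :=
      hmin (mem_closedBall_self hr.le)
    have h2 : a * ‖z - x‖ ^ 2 = 3 * ε := by rw [heq, ha]; field_simp
    simp only [sub_self, norm_zero] at h1
    linarith [hle z hz]
  have hgrad : HasGradientAt (fun w => φ w - a * ‖w - x‖ ^ 2) (φ' z - (2 * a) • (z - x)) z := by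
    rw [hasGradientAt_iff_hasFDerivAt, map_sub]
    refine (hφ z hz).hasFDerivAt.sub ?_
    have := (((hasFDerivAt_id z).sub_const x).norm_sq).const_mul a
    refine this.congr_fderiv ?_
    ext w
    simp
    ring
  refine ⟨z, hz, _, hgrad.mem_frechetSubdiff
    (hmin.isLocalMin (closedBall_mem_nhds_of_mem (by simpa [dist_eq_norm] using hlt))), ?_⟩
  have ha0 : 0 ≤ 2 * a := by positivity
  rw [sub_sub_cancel, norm_smul, Real.norm_of_nonneg ha0]
  calc 2 * a * ‖z - x‖ ≤ 2 * a * r := by gcongr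
    _ = 6 * ε / r := by rw [ha]; field_simp; ring

/-- Lemma on subdifferentials: the `c`-subdifferential of `u` on a slightly
smaller ellipsoid is contained in a neighborhood of the subdifferential of `v` on the
ellipsoid. -/
theorem cSubdiff_subset_nbhd_subdiff
    (n : ℕ) (K : ℝ) (hK : 1 ≤ K) :
    ∃ K' > (0 : ℝ), ∀ (X Y : Set (Euc n)) (c : Euc n → Euc n → ℝ) (u v : Euc n → ℝ)
      (D : Euc n →L[ℝ] Euc n) (x₀ : Euc n) (h ε δ : ℝ),
      IsSelfAdjoint D →
      (∀ ξ : Euc n, ‖ξ‖ ^ 2 / K ≤ ⟪D ξ, ξ⟫ ∧ ⟪D ξ, ξ⟫ ≤ K * ‖ξ‖ ^ 2) →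
      {x : Euc n | ⟪D (x - x₀), x - x₀⟫ ≤ h} ⊆ X →
      CConvexOn X Y c u →
      ConvexOn ℝ Set.univ v →
      (∀ x ∈ {x : Euc n | ⟪D (x - x₀), x - x₀⟫ ≤ h}, |v x - u x| ≤ ε) →
      CostC2CloseOn c
        ({x : Euc n | ⟪D (x - x₀), x - x₀⟫ ≤ h} ×ˢ
          ⋃ x ∈ {x : Euc n | ⟪D (x - x₀), x - x₀⟫ ≤ h}, cSubdiff X (closure Y) c u x) δ →
      0 < δ → 0 < ε → ε < h ^ 2 → h ≤ 1 →
      (⋃ x ∈ {x : Euc n | ⟪D (x - x₀), x - x₀⟫ ≤ h - Real.sqrt ε},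
          cSubdiff X (closure Y) c u x) ⊆
        Metric.cthickening (K' * (δ + Real.sqrt (h * ε)))
          (⋃ x ∈ {x : Euc n | ⟪D (x - x₀), x - x₀⟫ ≤ h}, frechetSubdiff v x) := by
  have hK0 : 0 < K := by linarith
  refine ⟨12 * K, by positivity, ?_⟩
  intro X Y c u v D x₀ h ε δ hD hell hEX _ hv huv hc hδ hε hεh _ y hy
  simp only [mem_iUnion] at hy
  obtain ⟨x, hx, hyx⟩ := hy
  set E := {x : Euc n | ⟪D (x - x₀), x - x₀⟫ ≤ h} with hE
  have hpos (η : Euc n) : 0 ≤ ⟪D η, η⟫ := le_trans (by positivity) (hell η).1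
  set s := √ε with hs
  have hs0 : 0 < s := Real.sqrt_pos.2 hε
  have hss : s ^ 2 = ε := Real.sq_sqrt hε.le
  have hh : 0 < h := by
    have : ⟪D (x - x₀), x - x₀⟫ ≤ h - s := hx
    linarith [hpos (x - x₀)]
  set t := √(h * K) with ht
  have ht0 : 0 < t := Real.sqrt_pos.2 (by positivity)
  have htt : t ^ 2 = h * K := Real.sq_sqrt (by positivity)
  set r := s / (2 * t) with hr
  have hr0 : 0 < r := by positivity
  have hball : closedBall x r ⊆ E := by
    intro z hz
    have hzr : ‖z - x‖ ≤ r := by simpa [dist_eq_norm] using hz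
    have hw : 4 * h * (K * ‖z - x‖ ^ 2) ≤ s ^ 2 := calc
      _ = 4 * t ^ 2 * ‖z - x‖ ^ 2 := by rw [htt]; ring
      _ ≤ 4 * t ^ 2 * r ^ 2 := by gcongr
      _ = s ^ 2 := by rw [hr]; field_simp; norm_num
    have := inner_map_add_le hD hpos (hell (z - x)).2 hh hs0 hx hw
    rwa [show x - x₀ + (z - x) = z - x₀ by abel] at this
  have hxE : x ∈ E := hball (mem_closedBall_self hr0.le)
  have hgrad : ∀ z ∈ E, ∃ g : Euc n, ‖g‖ ≤ δ ∧ HasGradientAt (fun w => c w y) (g - y) z :=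
    fun z hz => hc.exists_hasGradientAt ⟨hz, mem_biUnion hxE hyx⟩
  choose! g hgδ hg using hgrad
  obtain ⟨z, hz, p, hp, hzp⟩ := exists_mem_frechetSubdiff_norm_sub_le (v := v)
    (φ := fun w => -c w y + (c x y + u x)) (φ' := fun w => -(g w - y)) hε hr0
    ((hv.continuousOn isOpen_univ).mono (subset_univ _))
    (fun w hw => by
      rw [hasGradientAt_iff_hasFDerivAt, map_neg]
      exact (hg w (hball hw)).hasFDerivAt.neg.add_const _)
    (fun w hw => by
      have h1 := hyx.2 w (hEX (hball hw))
      have h2 := (abs_le.1 (huv w (hball hw))).1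
      linarith)
    (by linarith [(abs_le.1 (huv x hxE)).2])
  refine mem_cthickening_of_dist_le y p _ _ (mem_biUnion (hball hz) hp) ?_
  have hrad : 6 * ε / r ≤ 12 * K * √(h * ε) := by
    have hKK : √K ≤ K := Real.sqrt_le_iff.2 ⟨hK0.le, by nlinarith⟩
    calc 6 * ε / r = 12 * √K * √(h * ε) := by
          rw [Real.sqrt_mul hh.le, ← hs, hr, ← hss, ht, Real.sqrt_mul hh.le]
          field_simp
          norm_num
      _ ≤ 12 * K * √(h * ε) := by gcongr
  calc dist y p = ‖g z + (-(g z - y) - p)‖ := by rw [dist_eq_norm]; congr 1; abel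
    _ ≤ δ + 12 * K * √(h * ε) :=
        (norm_add_le _ _).trans (add_le_add (hgδ z (hball hz)) (hzp.trans hrad))
    _ ≤ 12 * K * (δ + √(h * ε)) := by nlinarith
end
end

section
/- Let X, Y ⊂ ℝ^n be open with Y bounded, and let c : X × closure(Y) → ℝ be continuously differentiable in x and such that for each x ∈ X the map y ↦ −D_x c(x,y) is injective on closure(Y). Let u : X → ℝ be c-convex, let x ∈ X be a point where u is differentiable, and assume ∂_c u(x) is nonempty. Then ∂_c u(x) is a singleton: ∂_c u(x) = {y}, where y ∈ closure(Y) is the unique point satisfying −D_x c(x,y) = ∇u(x); in other words, every local c-support of u at x is a global c-support, and ∂_c u(x) = c-exp_x(∂⁻u(x)) = {c-exp_x(∇u(x))}. -/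
open MeasureTheory Metric Set Filter Asymptotics
open scoped ENNReal NNReal RealInnerProductSpace Pointwise Topology

noncomputable section

/-- At an interior point of differentiability, every `c`-support has `-D_x c = ∇u`. -/
theorem neg_gradient_eq_of_mem_cSubdiff {n : ℕ} {X Ybar : Set (Euc n)}
    {c : Euc n → Euc n → ℝ} {u : Euc n → ℝ} {x y : Euc n} (hX : X ∈ 𝓝 x)
    (hc : DifferentiableAt ℝ (fun w => c w y) x) (hu : DifferentiableAt ℝ u x)
    (hy : y ∈ cSubdiff X Ybar c u x) :
    -gradient (fun w => c w y) x = gradient u x := by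
  have hmin : IsLocalMin (fun z => u z + c z y) x := by
    filter_upwards [hX] with z hz
    linarith [hy.2 z hz]
  have h := hmin.hasFDerivAt_eq_zero (hu.hasFDerivAt.add hc.hasFDerivAt)
  rw [gradient, gradient, ← map_neg, eq_neg_of_add_eq_zero_left h]

/-- local to global principle: at a differentiability point the
`c`-subdifferential is the singleton `{c-exp_x (∇u x)}`. -/
theorem cSubdiff_singleton_of_differentiable
    (n : ℕ) (X Y : Set (Euc n)) (c : Euc n → Euc n → ℝ) (u : Euc n → ℝ) (x : Euc n)
    (hX : IsOpen X) (hY : IsOpen Y) (hYb : Bornology.IsBounded Y)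
    (hc : ∀ y ∈ closure Y, ∀ z ∈ X, ContDiffAt ℝ 1 (fun w => c w y) z)
    (hinj : ∀ z ∈ X, Set.InjOn (fun y => -gradient (fun w => c w y) z) (closure Y))
    (hu : CConvexOn X Y c u) (hx : x ∈ X) (hdiff : DifferentiableAt ℝ u x)
    (hne : (cSubdiff X (closure Y) c u x).Nonempty) :
    ∃ y ∈ closure Y, cSubdiff X (closure Y) c u x = {y} ∧
      -gradient (fun w => c w y) x = gradient u x ∧
      ∀ y' ∈ closure Y, -gradient (fun w => c w y') x = gradient u x → y' = y := by
  obtain ⟨y, hy⟩ := hne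
  have key : ∀ y' ∈ cSubdiff X (closure Y) c u x,
      -gradient (fun w => c w y') x = gradient u x := fun y' hy' =>
    neg_gradient_eq_of_mem_cSubdiff (hX.mem_nhds hx)
      ((hc y' hy'.1 x hx).differentiableAt one_ne_zero) hdiff hy'
  have uniq : ∀ y' ∈ closure Y, -gradient (fun w => c w y') x = gradient u x → y' = y :=
    fun y' hy' h => hinj x hx hy' hy.1 (h.trans (key y hy).symm)
  exact ⟨y, hy.1, Set.eq_singleton_iff_unique_mem.2
    ⟨hy, fun y' hy' => uniq y' hy'.1 (key y' hy')⟩, key y hy, uniq⟩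
end
end

section
/- Let Λ ≥ 1, let u : B_{1/5} → ℝ be semiconvex with constant Λ (i.e. x ↦ u(x) + Λ|x|²/2 is convex on B_{1/5}), and let v ∈ C²(B_{1/5}) with ‖v‖_{C²(B_{1/5})} ≤ Λ. There exists a constant K′ depending only on n and Λ such that, if ‖u − v‖_{C⁰(B_{1/5})} ≤ (1/5 − 1/7)², then for every x ∈ B_{1/7} and every p ∈ ∂⁻u(x) one has |p − ∇v(x)| ≤ K′ √( ‖u − v‖_{C⁰(B_{1/5})} ). -/
open MeasureTheory Metric Set Filter Asymptotics
open scoped ENNReal NNReal RealInnerProductSpace Pointwise Topology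

noncomputable section

/-- A Frechet subgradient of a semiconvex function supports it from below by a paraboloid. -/
theorem le_of_mem_frechetSubdiff_of_semiconvex {n : ℕ} {Λ : ℝ} (hΛ : 0 ≤ Λ) {s : Set (Euc n)}
    {u : Euc n → ℝ} (hu : ConvexOn ℝ s (fun x => u x + Λ * ‖x‖ ^ 2 / 2))
    {x p : Euc n} (hx : x ∈ s) (hp : p ∈ frechetSubdiff u x) {w : Euc n} (hw : x + w ∈ s) :
    u x + ⟪p, w⟫ - Λ / 2 * ‖w‖ ^ 2 ≤ u (x + w) := by
  have expand : ∀ t : ℝ, ‖x + t • w‖ ^ 2 = ‖x‖ ^ 2 + 2 * t * ⟪x, w⟫ + t ^ 2 * ‖w‖ ^ 2 := by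
    intro t
    rw [norm_add_sq_real, inner_smul_right, norm_smul, mul_pow, Real.norm_eq_abs, sq_abs]
    ring
  have key : ∀ δ > 0, u x + ⟪p, w⟫ - Λ / 2 * ‖w‖ ^ 2 ≤ u (x + w) + δ * ‖w‖ := by
    intro δ hδ
    have hlim : Tendsto (fun t : ℝ => x + t • w) (𝓝[>] 0) (𝓝 x) := by
      have : Continuous (fun t : ℝ => x + t • w) := by fun_prop
      simpa using (this.tendsto 0).mono_left nhdsWithin_le_nhds
    have h01 : ∀ᶠ t : ℝ in 𝓝[>] 0, t ∈ Ioo (0 : ℝ) 1 := Ioo_mem_nhdsGT one_pos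
    obtain ⟨t, h, ht0, ht1⟩ := ((hlim.eventually (hp δ hδ)).and h01).exists
    have hc := hu.2 hx hw (sub_nonneg.2 ht1.le) ht0.le (sub_add_cancel 1 t)
    have hz : (1 - t) • x + t • (x + w) = x + t • w := by module
    have h1 := expand 1
    simp only [one_smul] at h1
    simp only [hz, smul_eq_mul, expand t, h1] at hc
    simp only [add_sub_cancel_left, inner_smul_right, norm_smul, Real.norm_eq_abs,
      abs_of_pos ht0] at h
    refine le_of_mul_le_mul_left ?_ ht0
    have : 0 ≤ Λ * (t ^ 2 * ‖w‖ ^ 2) := by positivity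
    nlinarith
  refine le_of_forall_pos_le_add fun δ hδ => ?_
  have h := key (δ / (‖w‖ + 1)) (by positivity)
  have : δ / (‖w‖ + 1) * ‖w‖ ≤ δ := by
    rw [div_mul_eq_mul_div, div_le_iff₀ (by positivity)]
    nlinarith
  linarith

/-- A `C²` function on an open convex set whose gradient has derivative bounded by `Λ` lies below
the paraboloid of opening `Λ` tangent to it. -/
theorem le_add_inner_gradient_of_norm_fderiv_gradient_le {n : ℕ} {Λ : ℝ} {s : Set (Euc n)}
    (hs : IsOpen s) (hconv : Convex ℝ s) {v : Euc n → ℝ} (hv : ContDiffOn ℝ 2 v s)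
    (hb : ∀ y ∈ s, ‖fderiv ℝ (gradient v) y‖ ≤ Λ)
    {x w : Euc n} (hx : x ∈ s) (hw : x + w ∈ s) :
    v (x + w) ≤ v x + ⟪gradient v x, w⟫ + Λ * ‖w‖ ^ 2 := by
  have hΛ : 0 ≤ Λ := (norm_nonneg _).trans (hb x hx)
  have hdv : ∀ y ∈ s, DifferentiableAt ℝ v y := fun y hy =>
    (hv.differentiableOn (by norm_num)).differentiableAt (hs.mem_nhds hy)
  have hdg : ∀ y ∈ s, DifferentiableAt ℝ (gradient v) y := fun y hy =>
    (InnerProductSpace.toDual ℝ (Euc n)).symm.toContinuousLinearEquiv.differentiableAt.comp y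
      (((hv.fderiv_of_isOpen hs (m := 1) (by norm_num)).differentiableOn
        (by norm_num)).differentiableAt (hs.mem_nhds hy))
  have hseg : segment ℝ x (x + w) ⊆ s := hconv.segment_subset hx hw
  have hbound : ∀ y ∈ segment ℝ x (x + w), ‖fderiv ℝ v y - fderiv ℝ v x‖ ≤ Λ * ‖w‖ := by
    intro y hy
    have h1 := hconv.norm_image_sub_le_of_norm_fderiv_le hdg hb hx (hseg hy)
    have h2 : ‖y - x‖ ≤ ‖w‖ := by simpa using norm_sub_le_of_mem_segment hy
    have h3 : ‖gradient v y - gradient v x‖ = ‖fderiv ℝ v y - fderiv ℝ v x‖ := by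
      rw [gradient, gradient, ← map_sub, LinearIsometryEquiv.norm_map]
    rw [← h3]
    exact h1.trans (mul_le_mul_of_nonneg_left h2 hΛ)
  have h := (convex_segment x (x + w)).norm_image_sub_le_of_norm_hasFDerivWithin_le'
    (fun y hy => (hdv y (hseg hy)).hasFDerivAt.hasFDerivWithinAt) hbound
    (left_mem_segment ℝ x (x + w)) (right_mem_segment ℝ x (x + w))
  have hin : ⟪gradient v x, w⟫ = fderiv ℝ v x w := by
    simp [gradient]
  rw [add_sub_cancel_left, Real.norm_eq_abs] at h
  rw [hin]
  nlinarith [le_abs_self (v (x + w) - v x - fderiv ℝ v x w)]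

/-- interpolation: if a `Λ`-semiconvex function `u` is `ε`-close in `C⁰(B_{1/5})`
to a function `v` with `C²` norm at most `Λ`, with `ε ≤ (1/5 - 1/7)²`, then every Frechet
subgradient of `u` on `B_{1/7}` is `K′ √ε`-close to `∇v`. -/
theorem frechetSubdiff_close_of_C0_close
    (n : ℕ) (Λ : ℝ) (hΛ : 1 ≤ Λ) :
    ∃ K' > (0 : ℝ), ∀ (u v : Euc n → ℝ) (ε : ℝ),
      ConvexOn ℝ (ball (0 : Euc n) (1 / 5)) (fun x => u x + Λ * ‖x‖ ^ 2 / 2) →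
      ContDiffOn ℝ 2 v (ball (0 : Euc n) (1 / 5)) →
      (∀ x ∈ ball (0 : Euc n) (1 / 5),
        |v x| ≤ Λ ∧ ‖gradient v x‖ ≤ Λ ∧ ‖fderiv ℝ (gradient v) x‖ ≤ Λ) →
      0 ≤ ε → (∀ x ∈ ball (0 : Euc n) (1 / 5), |u x - v x| ≤ ε) →
      ε ≤ (1 / 5 - 1 / 7) ^ 2 →
      ∀ x ∈ ball (0 : Euc n) (1 / 7), ∀ p ∈ frechetSubdiff u x,
        ‖p - gradient v x‖ ≤ K' * Real.sqrt ε := by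
  have hK : (0 : ℝ) < 2 + 3 / 2 * Λ := by linarith
  refine ⟨2 + 3 / 2 * Λ, hK, ?_⟩
  intro u v ε hu hv hb hε huv hεle x hx p hp
  have hx7 : ‖x‖ < 1 / 7 := by simpa using hx
  have hx5 : x ∈ ball (0 : Euc n) (1 / 5) := ball_subset_ball (by norm_num) hx
  set q := p - gradient v x with hq
  have key : ∀ s : ℝ, 0 < s → ε ≤ s ^ 2 → s ≤ 1 / 5 - 1 / 7 →
      ‖q‖ ≤ (2 + 3 / 2 * Λ) * s := by
    intro s hs hεs hs'
    rcases eq_or_ne q 0 with h0 | h0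
    · rw [h0, norm_zero]
      positivity
    have hqpos : 0 < ‖q‖ := norm_pos_iff.2 h0
    set w : Euc n := (s / ‖q‖) • q with hw
    have hwn : ‖w‖ = s := by
      rw [hw, norm_smul, Real.norm_eq_abs, abs_of_pos (by positivity)]
      field_simp
    have hqw : ⟪p, w⟫ - ⟪gradient v x, w⟫ = s * ‖q‖ := by
      rw [← inner_sub_left, ← hq, hw, inner_smul_right, real_inner_self_eq_norm_sq]
      field_simp
    have hxw : x + w ∈ ball (0 : Euc n) (1 / 5) := by
      rw [mem_ball_zero_iff]
      linarith [norm_add_le x w]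
    have h1 := le_of_mem_frechetSubdiff_of_semiconvex (by linarith) hu hx5 hp hxw
    have h2 := le_add_inner_gradient_of_norm_fderiv_gradient_le isOpen_ball (convex_ball _ _) hv
      (fun y hy => (hb y hy).2.2) hx5 hxw
    have h3 := abs_le.1 (huv x hx5)
    have h4 := abs_le.1 (huv _ hxw)
    rw [hwn] at h1 h2
    refine le_of_mul_le_mul_left ?_ hs
    nlinarith
  rcases hε.eq_or_lt with h0 | h0
  · rw [← h0, Real.sqrt_zero, mul_zero]
    have hlim : Tendsto (fun s : ℝ => (2 + 3 / 2 * Λ) * s) (𝓝[>] 0) (𝓝 0) := by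
      have : Continuous (fun s : ℝ => (2 + 3 / 2 * Λ) * s) := by fun_prop
      simpa using (this.tendsto 0).mono_left nhdsWithin_le_nhds
    refine ge_of_tendsto hlim ?_
    filter_upwards [Ioo_mem_nhdsGT (show (0 : ℝ) < 1 / 5 - 1 / 7 by norm_num)] with s hs
    exact key s hs.1 (by rw [← h0]; positivity) hs.2.le
  · exact key _ (Real.sqrt_pos.2 h0) (Real.sq_sqrt hε).ge
      (Real.sqrt_le_iff.2 ⟨by norm_num, hεle⟩)
end
end

section
/- Let K ≥ 1, let c : B_K×B_K → ℝ be a C² cost such that for each x ∈ B_K the map y ↦ −D_x c(x,y) is injective on B_K, and let Ω ⊂ B_K be a convex open set. Let w ∈ C²(Ω) be such that for every x ∈ Ω there exists y(x) := c-exp_x(∇w(x)) ∈ B_K (i.e. ∇w(x) = −D_x c(x, y(x))), and suppose that D²w(x) > ‖D_{xx}c‖_{C⁰(B_K×B_K)} · Id for all x ∈ Ω, in the sense of quadratic forms. Then the map x ↦ y(x) = c-exp_x(∇w(x)) is injective on Ω. -/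
open MeasureTheory Metric Set Filter Asymptotics
open scoped ENNReal NNReal RealInnerProductSpace Pointwise Topology

noncomputable section

/-- The gradient of a `C²` function on an open set is differentiable there. -/
theorem ContDiffOn.differentiableAt_gradient {F : Type*} [NormedAddCommGroup F]
    [InnerProductSpace ℝ F] [CompleteSpace F] {f : F → ℝ} {s : Set F} (hs : IsOpen s)
    (hf : ContDiffOn ℝ 2 f s) {x : F} (hx : x ∈ s) :
    DifferentiableAt ℝ (gradient f) x := by
  have h : ContDiffAt ℝ 1 (fderiv ℝ f) x :=
    (hf.contDiffAt (hs.mem_nhds hx)).fderiv_right (by norm_num)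
  exact ((InnerProductSpace.toDual ℝ F).symm.toContinuousLinearEquiv.differentiableAt).comp x
    (h.differentiableAt (by norm_num))

/-- A vector field with positive definite derivative on a convex set is injective there. -/
theorem Convex.injOn_of_inner_fderiv_pos {F : Type*} [NormedAddCommGroup F]
    [InnerProductSpace ℝ F] {G : F → F} {s : Set F} (hs : Convex ℝ s)
    (hG : ∀ x ∈ s, DifferentiableAt ℝ G x)
    (hpos : ∀ x ∈ s, ∀ ξ : F, ξ ≠ 0 → 0 < ⟪fderiv ℝ G x ξ, ξ⟫) :
    Set.InjOn G s := by
  intro a ha b hb hab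
  by_contra hne
  have hv : b - a ≠ 0 := sub_ne_zero.mpr (Ne.symm hne)
  have hmem : ∀ t ∈ Set.Icc (0 : ℝ) 1, a + t • (b - a) ∈ s := fun t ht =>
    hs.add_smul_sub_mem ha hb ht
  have hderiv : ∀ t ∈ Set.Icc (0 : ℝ) 1,
      HasDerivAt (fun t : ℝ => ⟪G (a + t • (b - a)), b - a⟫)
        ⟪fderiv ℝ G (a + t • (b - a)) (b - a), b - a⟫ t := by
    intro t ht
    have hline : HasDerivAt (fun t : ℝ => a + t • (b - a)) (b - a) t := by
      simpa using ((hasDerivAt_id t).smul_const (b - a)).const_add a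
    have hcomp := (hG _ (hmem t ht)).hasFDerivAt.comp_hasDerivAt t hline
    simpa using hcomp.inner ℝ (hasDerivAt_const t (b - a))
  obtain ⟨t, ht, ht0⟩ := exists_hasDerivAt_eq_zero (zero_lt_one' ℝ)
    (fun t ht => (hderiv t ht).continuousAt.continuousWithinAt)
    (by simp [hab]) (fun t ht => hderiv t (Ioo_subset_Icc_self ht))
  exact (hpos _ (hmem t (Ioo_subset_Icc_self ht)) _ hv).ne' ht0

/-- if `D²w > ‖D_{xx}c‖_{C⁰} Id` on a convex set `Ω`, then the map
`x ↦ c-exp_x (∇w x)` is injective on `Ω`. -/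
theorem cexp_grad_injective
    (n : ℕ) (K : ℝ) (c : Euc n → Euc n → ℝ) (Ω : Set (Euc n))
    (w : Euc n → ℝ) (y : Euc n → Euc n) (Mc : ℝ)
    (hK : 1 ≤ K)
    (hc : ContDiffOn ℝ 2 (fun q : Euc n × Euc n => c q.1 q.2)
      (ball (0 : Euc n) K ×ˢ ball (0 : Euc n) K))
    (hinj : ∀ x ∈ ball (0 : Euc n) K,
      Set.InjOn (fun y' => -gradient (fun z => c z y') x) (ball (0 : Euc n) K))
    (hΩ : IsOpen Ω) (hΩc : Convex ℝ Ω) (hΩK : Ω ⊆ ball (0 : Euc n) K)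
    (hw : ContDiffOn ℝ 2 w Ω)
    (hy : ∀ x ∈ Ω, y x ∈ ball (0 : Euc n) K ∧
      gradient (fun z => c z (y x)) x = -gradient w x)
    (hMc : ∀ x ∈ ball (0 : Euc n) K, ∀ y' ∈ ball (0 : Euc n) K,
      ‖fderiv ℝ (fun z => gradient (fun w' => c w' y') z) x‖ ≤ Mc)
    (hpos : ∀ x ∈ Ω, ∀ ξ : Euc n, ξ ≠ 0 →
      Mc * ‖ξ‖ ^ 2 < ⟪fderiv ℝ (gradient w) x ξ, ξ⟫) :
    Set.InjOn y Ω := by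
  intro a ha b hb hab
  obtain ⟨hya, hga⟩ := hy a ha
  obtain ⟨-, hgb⟩ := hy b hb
  rw [← hab] at hgb
  have hcy : ContDiffOn ℝ 2 (fun z => c z (y a)) (ball (0 : Euc n) K) :=
    hc.comp (contDiff_id.prodMk contDiff_const).contDiffOn fun z hz => ⟨hz, hya⟩
  have hdw : ∀ x ∈ Ω, DifferentiableAt ℝ (gradient w) x := fun x hx =>
    hw.differentiableAt_gradient hΩ hx
  have hdc : ∀ x ∈ Ω, DifferentiableAt ℝ (gradient fun z => c z (y a)) x := fun x hx =>
    hcy.differentiableAt_gradient isOpen_ball (hΩK hx)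
  refine hΩc.injOn_of_inner_fderiv_pos (G := gradient w + gradient fun z => c z (y a))
    (fun x hx => (hdw x hx).add (hdc x hx)) (fun x hx ξ hξ => ?_) ha hb ?_
  · rw [fderiv_add (hdw x hx) (hdc x hx), add_apply, inner_add_left]
    have hw_pos := hpos x hx ξ hξ
    have hbound : |⟪fderiv ℝ (gradient fun z => c z (y a)) x ξ, ξ⟫| ≤ Mc * ‖ξ‖ ^ 2 :=
      calc _ ≤ ‖fderiv ℝ (gradient fun z => c z (y a)) x ξ‖ * ‖ξ‖ := abs_real_inner_le_norm _ _
        _ ≤ Mc * ‖ξ‖ * ‖ξ‖ := by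
            gcongr
            exact ContinuousLinearMap.le_of_opNorm_le _ (hMc x (hΩK hx) _ hya) ξ
        _ = Mc * ‖ξ‖ ^ 2 := by ring
    linarith [neg_le_of_abs_le hbound]
  · simp [hga, hgb]
end
end

section
/- Let K ≥ 1 and let S ⊂ B_K ⊂ ℝ^n be a closed set which is δ-semiconvex in the following sense: for every pair of points x₀, x₁ ∈ S, the ball centered at the midpoint (x₀+x₁)/2 of radius δ|x₁−x₀|² intersects S. Then there exist constants δ₁(K) > 0 and C_K (depending only on n and K) such that, if δ ≤ δ₁(K), the convex hull of S is contained in the C_K δ-neighborhood of S: co[S] ⊂ N_{C_K δ}(S). -/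
open MeasureTheory Metric Set Filter Asymptotics
open scoped ENNReal NNReal RealInnerProductSpace Pointwise Topology

noncomputable section

/-- Every point of a segment with endpoints in a `δ`-semiconvex set `S` is at distance
`O(δ ‖x₁ - x₀‖ ^ 2)` from `S`. -/
theorem infDist_segment_le_of_semiconvex {E : Type*} [NormedAddCommGroup E] [NormedSpace ℝ E]
    {S : Set E} {δ D : ℝ} (hδ : 0 ≤ δ) (hδD : δ * D ≤ 1 / 4)
    (hD : ∀ x₀ ∈ S, ∀ x₁ ∈ S, ‖x₁ - x₀‖ ≤ D)
    (hS : ∀ x₀ ∈ S, ∀ x₁ ∈ S, ∃ z ∈ S, ‖z - midpoint ℝ x₀ x₁‖ ≤ δ * ‖x₁ - x₀‖ ^ 2)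
    {x₀ x₁ y : E} (h₀ : x₀ ∈ S) (h₁ : x₁ ∈ S) (hy : y ∈ segment ℝ x₀ x₁) :
    infDist y S ≤ 3 * δ * ‖x₁ - x₀‖ ^ 2 := by
  have key : ∀ k : ℕ, ∀ x₀ ∈ S, ∀ x₁ ∈ S, ∀ t ∈ Icc (0 : ℝ) 1,
      infDist (x₀ + t • (x₁ - x₀)) S ≤
        3 * δ * ‖x₁ - x₀‖ ^ 2 + (3 / 4 : ℝ) ^ k * ‖x₁ - x₀‖ := by
    intro k
    induction k with
    | zero =>
      rintro x₀ h₀ x₁ h₁ t ⟨ht0, ht1⟩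
      refine (infDist_le_dist_of_mem h₀).trans ?_
      rw [dist_eq_norm, add_sub_cancel_left, norm_smul, Real.norm_of_nonneg ht0]
      have : 0 ≤ 3 * δ * ‖x₁ - x₀‖ ^ 2 := by positivity
      nlinarith [norm_nonneg (x₁ - x₀)]
    | succ k ih =>
      have half : ∀ x₀ ∈ S, ∀ x₁ ∈ S, ∀ t ∈ Icc (0 : ℝ) (1 / 2),
          infDist (x₀ + t • (x₁ - x₀)) S ≤
            3 * δ * ‖x₁ - x₀‖ ^ 2 + (3 / 4 : ℝ) ^ (k + 1) * ‖x₁ - x₀‖ := by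
        rintro x₀ h₀ x₁ h₁ t ⟨ht0, ht1⟩
        obtain ⟨z, hz, hzm⟩ := hS x₀ h₀ x₁ h₁
        have hmid : midpoint ℝ x₀ x₁ = x₀ + (1 / 2 : ℝ) • (x₁ - x₀) := by
          rw [midpoint_eq_smul_add, invOf_eq_inv]
          module
        rw [hmid] at hzm
        set d := ‖x₁ - x₀‖
        have hd0 : 0 ≤ d := norm_nonneg _
        have hδd : δ * d ≤ 1 / 4 :=
          (mul_le_mul_of_nonneg_left (hD x₀ h₀ x₁ h₁) hδ).trans hδD
        have hlen : ‖z - x₀‖ ≤ 3 / 4 * d := by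
          have : z - x₀ = (z - (x₀ + (1 / 2 : ℝ) • (x₁ - x₀))) + (1 / 2 : ℝ) • (x₁ - x₀) := by
            module
          rw [this]
          refine (norm_add_le _ _).trans ?_
          rw [norm_smul, Real.norm_of_nonneg (by norm_num)]
          nlinarith
        have hdist : dist (x₀ + t • (x₁ - x₀)) (x₀ + (2 * t) • (z - x₀)) ≤ δ * d ^ 2 := by
          have : x₀ + t • (x₁ - x₀) - (x₀ + (2 * t) • (z - x₀)) =
              -((2 * t) • (z - (x₀ + (1 / 2 : ℝ) • (x₁ - x₀)))) := by
            module
          rw [dist_eq_norm, this, norm_neg, norm_smul, Real.norm_of_nonneg (by positivity)]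
          exact (mul_le_of_le_one_left (norm_nonneg _) (by linarith)).trans hzm
        calc infDist (x₀ + t • (x₁ - x₀)) S
            ≤ infDist (x₀ + (2 * t) • (z - x₀)) S + δ * d ^ 2 :=
              infDist_le_infDist_add_dist.trans (by gcongr)
          _ ≤ 3 * δ * ‖z - x₀‖ ^ 2 + (3 / 4 : ℝ) ^ k * ‖z - x₀‖ + δ * d ^ 2 := by
              gcongr
              exact ih x₀ h₀ z hz (2 * t) ⟨by positivity, by linarith⟩
          _ ≤ 3 * δ * (3 / 4 * d) ^ 2 + (3 / 4 : ℝ) ^ k * (3 / 4 * d) + δ * d ^ 2 := by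
              gcongr
          _ ≤ 3 * δ * d ^ 2 + (3 / 4 : ℝ) ^ (k + 1) * d := by
              rw [pow_succ (3 / 4 : ℝ) k]
              have : 0 ≤ δ * d ^ 2 := by positivity
              linarith
      rintro x₀ h₀ x₁ h₁ t ⟨ht0, ht1⟩
      rcases le_total t (1 / 2) with ht | ht
      · exact half x₀ h₀ x₁ h₁ t ⟨ht0, ht⟩
      · have := half x₁ h₁ x₀ h₀ (1 - t) ⟨by linarith, by linarith⟩
        rw [norm_sub_rev x₀ x₁] at this
        convert this using 2
        module
  rw [segment_eq_image'] at hy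
  obtain ⟨t, ht, rfl⟩ := hy
  refine ge_of_tendsto' (x := atTop) ?_ fun k => key k x₀ h₀ x₁ h₁ t ht
  have := (tendsto_pow_atTop_nhds_zero_of_lt_one (r := (3 / 4 : ℝ)) (by norm_num)
    (by norm_num)).mul_const ‖x₁ - x₀‖
  simpa using this.const_add (3 * δ * ‖x₁ - x₀‖ ^ 2)

/-- If every segment with endpoints in a closed set `S` stays at distance at most `r` from `S`,
then the convex hull of `N` points of `S` stays at distance at most `N * r` from `S`. -/
theorem infDist_convexHull_finset_le {E : Type*} [NormedAddCommGroup E] [NormedSpace ℝ E]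
    [ProperSpace E] {S : Set E} {r : ℝ} (hS : IsClosed S) (hr : 0 ≤ r)
    (hseg : ∀ x₀ ∈ S, ∀ x₁ ∈ S, ∀ y ∈ segment ℝ x₀ x₁, infDist y S ≤ r)
    (t : Finset E) (htS : (t : Set E) ⊆ S) :
    ∀ y ∈ convexHull ℝ (t : Set E), infDist y S ≤ t.card * r := by
  classical
  induction t using Finset.induction_on with
  | empty => simp
  | insert a t hat ih =>
    rw [Finset.coe_insert, insert_subset_iff] at htS
    obtain ⟨haS, htS⟩ := htS
    intro y hy
    rw [Finset.coe_insert] at hy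
    rw [Finset.card_insert_of_notMem hat]
    push_cast
    rcases t.eq_empty_or_nonempty with rfl | hne
    · have : y = a := by simpa using hy
      rw [this, infDist_zero_of_mem haS]
      positivity
    · rw [convexHull_insert (by simpa using hne), mem_convexJoin] at hy
      obtain ⟨b, rfl, w, hw, hyw⟩ := hy
      obtain ⟨w', hw'S, hw'⟩ := hS.exists_infDist_eq_dist ⟨_, haS⟩ w
      have hww' : dist w w' ≤ t.card * r := hw' ▸ ih htS w hw
      rw [segment_eq_image] at hyw
      obtain ⟨s, hs, rfl⟩ := hyw
      have hmem : (1 - s) • b + s • w' ∈ segment ℝ b w' := by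
        rw [segment_eq_image]
        exact ⟨s, hs, rfl⟩
      have hdist : dist ((1 - s) • b + s • w) ((1 - s) • b + s • w') ≤ t.card * r := by
        rw [dist_add_left, dist_smul₀, Real.norm_of_nonneg hs.1]
        exact (mul_le_of_le_one_left dist_nonneg hs.2).trans hww'
      have := hseg b haS w' hw'S _ hmem
      linarith [infDist_le_infDist_add_dist (s := S) (x := (1 - s) • b + s • w)
        (y := (1 - s) • b + s • w')]

/-- a `δ`-semiconvex closed set `S ⊆ B_K` has its convex hull contained in the
`C_K δ`-neighborhood of `S`, provided `δ ≤ δ₁ (K)`. -/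
theorem convexHull_subset_thickening_of_semiconvex
    (n : ℕ) (K : ℝ) (hK : 1 ≤ K) :
    ∃ δ₁ > (0 : ℝ), ∃ C > (0 : ℝ), ∀ (S : Set (Euc n)) (δ : ℝ),
      IsClosed S → S ⊆ ball (0 : Euc n) K → 0 ≤ δ → δ ≤ δ₁ →
      (∀ x₀ ∈ S, ∀ x₁ ∈ S, ∃ z ∈ S, ‖z - midpoint ℝ x₀ x₁‖ ≤ δ * ‖x₁ - x₀‖ ^ 2) →
      convexHull ℝ S ⊆ Metric.cthickening (C * δ) S := by
  refine ⟨1 / (8 * K), by positivity, (n + 1) * (12 * K ^ 2), by positivity, ?_⟩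
  intro S δ hcl hSK hδ hδ₁ hS y hy
  have hD : ∀ x₀ ∈ S, ∀ x₁ ∈ S, ‖x₁ - x₀‖ ≤ 2 * K := by
    intro x₀ h₀ x₁ h₁
    have h₀' := mem_ball_zero_iff.1 (hSK h₀)
    have h₁' := mem_ball_zero_iff.1 (hSK h₁)
    linarith [norm_sub_le x₁ x₀]
  have hδD : δ * (2 * K) ≤ 1 / 4 := by
    rw [le_div_iff₀ (by positivity)] at hδ₁
    linarith
  have hseg : ∀ x₀ ∈ S, ∀ x₁ ∈ S, ∀ y ∈ segment ℝ x₀ x₁, infDist y S ≤ 12 * K ^ 2 * δ := by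
    intro x₀ h₀ x₁ h₁ y hy
    calc infDist y S ≤ 3 * δ * ‖x₁ - x₀‖ ^ 2 :=
          infDist_segment_le_of_semiconvex hδ hδD hD hS h₀ h₁ hy
      _ ≤ 3 * δ * (2 * K) ^ 2 := by gcongr; exact hD x₀ h₀ x₁ h₁
      _ = 12 * K ^ 2 * δ := by ring
  have hne : S.Nonempty := convexHull_nonempty_iff.1 ⟨y, hy⟩
  rw [convexHull_eq_union] at hy
  simp only [mem_iUnion] at hy
  obtain ⟨t, htS, hind, hyt⟩ := hy
  have hcard : t.card ≤ n + 1 := by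
    have h := hind.card_le_finrank_succ
    rw [Fintype.card_coe] at h
    refine h.trans (Nat.succ_le_succ ((Submodule.finrank_le _).trans ?_))
    simp
  rw [hcl.cthickening_eq_biUnion_closedBall (by positivity)]
  obtain ⟨z, hz, hyz⟩ := hcl.exists_infDist_eq_dist hne y
  refine mem_iUnion₂.2 ⟨z, hz, ?_⟩
  rw [mem_closedBall, ← hyz]
  calc infDist y S ≤ t.card * (12 * K ^ 2 * δ) :=
        infDist_convexHull_finset_le hcl (by positivity) hseg t htS y hyt
    _ ≤ ((n + 1 : ℕ) : ℝ) * (12 * K ^ 2 * δ) := by gcongr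
    _ = (n + 1) * (12 * K ^ 2) * δ := by push_cast; ring
end
end
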